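/- arXiv:math/0212071 — 13 statements merged into one kernel-verified Lean document; each statement's English description precedes it below -/
import Mathlib

section
/- Let R be a noetherian integrally closed domain, complete for the I-adic topology defined by a radical ideal I of R (I = √I), and let K be the fraction field of R. Fix r ≥ 1 and elements β₁,…,β_r ∈ (Kˣ)^r; for m ∈ ℤ^r write β^m := ∏_j β_j^{m_j} ∈ (Kˣ)^r (componentwise product), and for α ∈ ℤ^r and w ∈ (Kˣ)^r write 𝔛^α(w) := ∏_i w_i^{α_i} ∈ Kˣ. Let φ : ℤ^r → ℤ^r be an additive map (a 'polarization') such that (i) 𝔛^{φ(m)}(β^{m'}) = 𝔛^{φ(m')}(β^m) for all m, m' ∈ ℤ^r, and (ii) 𝔛^{φ(m)}(β^m) lies in the image of I in K for every m ≠ 0. Then for every α ∈ ℤ^r there exists an integer n ≥ 1 such that 𝔛^{nφ(m)+α}(β^m) lies in the image of R in K for all m ∈ ℤ^r. -/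
open IsLocalRing in
/-- A prime whose localization has a uniformizer `π` gives a discrete valuation that detects
membership in that localization. -/
theorem exists_valuation_of_prime {R : Type*} (K : Type*) [CommRing R] [IsDomain R]
    [IsNoetherianRing R] [Field K] [Algebra R K] [IsFractionRing R K]
    (p : Ideal R) [p.IsPrime] {π u : R} (hπ : π ∈ p) (hπ0 : π ≠ 0) (hu : u ∉ p)
    (hdvd : ∀ d ∈ p, π ∣ u * d) :
    ∃ v : Valuation K (WithZero (Multiplicative ℤ)), (∀ a : R, v (algebraMap R K a) ≤ 1) ∧
      ∀ z : K, v z ≤ 1 → ∃ s ∉ p, ∃ a : R, algebraMap R K s * z = algebraMap R K a := by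
  let A := Localization.AtPrime p
  have hle : p.primeCompl ≤ nonZeroDivisors R := p.primeCompl_le_nonZeroDivisors
  have : IsDomain A := IsLocalization.isDomain_of_le_nonZeroDivisors A hle
  have : IsNoetherianRing A := IsLocalization.isNoetherianRing p.primeCompl A inferInstance
  let _ : Algebra A K :=
    IsLocalization.localizationAlgebraOfSubmonoidLe A K p.primeCompl (nonZeroDivisors R) hle
  have : IsScalarTower R A K :=
    IsLocalization.localization_isScalarTower_of_submonoid_le A K p.primeCompl _ hle
  have : IsFractionRing A K :=
    IsFractionRing.isFractionRing_of_isDomain_of_isLocalization p.primeCompl A K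
  have hmax : maximalIdeal A = Ideal.span {algebraMap R A π} := by
    rw [← Localization.AtPrime.map_eq_maximalIdeal]
    apply le_antisymm
    · rw [Ideal.map_le_iff_le_comap]
      intro d hd
      have hu' : IsUnit (algebraMap R A u) := IsLocalization.map_units A (⟨u, hu⟩ : p.primeCompl)
      rw [Ideal.mem_comap, Ideal.mem_span_singleton, ← hu'.dvd_mul_left, ← map_mul]
      exact map_dvd _ (hdvd d hd)
    · rw [Ideal.span_singleton_le_iff_mem]
      exact Ideal.mem_map_of_mem _ hπ
  have hfield : ¬ IsField A := by
    rw [isField_iff_maximalIdeal_eq, hmax, Ideal.span_singleton_eq_bot]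
    exact (map_ne_zero_iff _ (IsLocalization.injective A hle)).mpr hπ0
  have hprincipal : (maximalIdeal A).IsPrincipal := ⟨_, hmax⟩
  have : IsDiscreteValuationRing A :=
    ((IsDiscreteValuationRing.TFAE A hfield).out 4 0).mp hprincipal
  refine ⟨(IsDiscreteValuationRing.maximalIdeal A).valuation K, fun a => ?_, fun z hz => ?_⟩
  · rw [IsScalarTower.algebraMap_apply R A K]
    exact IsDedekindDomain.HeightOneSpectrum.valuation_le_one _ _
  · obtain ⟨b, rfl⟩ := IsDiscreteValuationRing.exists_lift_of_le_one hz
    obtain ⟨⟨a, s⟩, h⟩ := IsLocalization.surj p.primeCompl b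
    refine ⟨s, s.2, a, ?_⟩
    rw [IsScalarTower.algebraMap_apply R A K, IsScalarTower.algebraMap_apply R A K, ← h, map_mul,
      mul_comm]

/-- An associated prime of a nonzero principal ideal in a noetherian integrally closed domain gives
a discrete valuation that detects membership in the localization at that prime. -/
theorem exists_valuation_of_mem_associatedPrimes {R : Type*} (K : Type*) [CommRing R] [IsDomain R]
    [IsNoetherianRing R] [IsIntegrallyClosed R] [Field K] [Algebra R K] [IsFractionRing R K]
    {c : R} (hc : c ≠ 0) {p : Ideal R} (hp : p ∈ associatedPrimes R (R ⧸ Ideal.span {c})) :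
    ∃ v : Valuation K (WithZero (Multiplicative ℤ)), (∀ a : R, v (algebraMap R K a) ≤ 1) ∧
      ∀ z : K, v z ≤ 1 → ∃ s ∉ p, ∃ a : R, algebraMap R K s * z = algebraMap R K a := by
  obtain ⟨hprime, x, hx⟩ := Submodule.isAssociatedPrime_iff.mp (AssociatedPrimes.mem_iff.mp hp)
  obtain ⟨e, rfl⟩ := Ideal.Quotient.mk_surjective x
  have hmem (d : R) : d ∈ p ↔ c ∣ d * e := by
    rw [hx, Submodule.mem_colon_singleton, Submodule.mem_bot, ← Ideal.mem_span_singleton,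
      ← Ideal.Quotient.eq_zero_iff_mem, map_mul, Algebra.smul_def]
    rfl
  have hcp : c ∈ p := (hmem c).mpr (dvd_mul_right _ _)
  have hcK : algebraMap R K c ≠ 0 := (map_ne_zero_iff _ (IsFractionRing.injective R K)).mpr hc
  obtain ⟨π, hπ, u, hu, hue⟩ : ∃ π ∈ p, ∃ u ∉ p, π * e = c * u := by
    by_contra! h
    have hint : IsIntegral R (algebraMap R K e / algebraMap R K c) := by
      refine isIntegral_of_smul_mem_submodule (Submodule.map (Algebra.linearMap R K) p) ?_
        ((IsNoetherian.noetherian p).map _) _ ?_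
      · rw [Submodule.ne_bot_iff]
        exact ⟨_, ⟨c, hcp, rfl⟩, hcK⟩
      · rintro _ ⟨d, hd, rfl⟩
        obtain ⟨u, hu⟩ := (hmem d).mp hd
        refine ⟨u, by_contra fun hup => h d hd u hup hu, ?_⟩
        have := congrArg (algebraMap R K) hu
        simp only [map_mul] at this
        simp only [Algebra.linearMap_apply, smul_eq_mul]
        field_simp
        linear_combination -this
    obtain ⟨y, hy⟩ := IsIntegrallyClosed.isIntegral_iff.mp hint
    refine hprime.ne_top ((Ideal.eq_top_iff_one _).mpr ((hmem 1).mpr ⟨y, ?_⟩))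
    apply IsFractionRing.injective R K
    rw [one_mul, map_mul, hy, mul_div_cancel₀ _ hcK]
  refine exists_valuation_of_prime K p hπ ?_ hu fun d hd => ?_
  · rintro rfl
    rw [zero_mul, eq_comm, mul_eq_zero] at hue
    exact hu ((hue.resolve_left hc) ▸ p.zero_mem)
  · obtain ⟨d', hd'⟩ := (hmem d).mp hd
    refine ⟨d', mul_left_cancel₀ hc ?_⟩
    linear_combination π * hd' - d * hue

/-- The nonzero elements of `K` that lie in the image of `R`, written additively. -/
def integralUnits (R K : Type*) [CommRing R] [Field K] [Algebra R K] :
    AddSubmonoid (Additive Kˣ) :=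
  ((algebraMap R K).range.toSubmonoid.comap (Units.coeHom K)).toAddSubmonoid

theorem mem_integralUnits {R K : Type*} [CommRing R] [Field K] [Algebra R K] {u : Additive Kˣ} :
    u ∈ integralUnits R K ↔ (u.toMul : K) ∈ Set.range (algebraMap R K) :=
  Iff.rfl

theorem mem_integralUnits_of_nsmul_mem {R K : Type*} [CommRing R] [IsDomain R]
    [IsIntegrallyClosed R] [Field K] [Algebra R K] [IsFractionRing R K] {u : Additive Kˣ} {k : ℕ}
    (hk : 0 < k) (h : k • u ∈ integralUnits R K) : u ∈ integralUnits R K := by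
  obtain ⟨a, ha⟩ := mem_integralUnits.mp h
  refine IsIntegrallyClosed.exists_algebraMap_eq_of_isIntegral_pow (R := R) hk ?_
  rw [toMul_nsmul, Units.val_pow_eq_pow_val] at ha
  exact ha ▸ isIntegral_algebraMap

/-- The order function `-log ∘ v` of a `ℤ`-valued valuation. -/
noncomputable def Valuation.order {K : Type*} [Field K]
    (v : Valuation K (WithZero (Multiplicative ℤ))) : Additive Kˣ →+ ℤ :=
  AddMonoidHom.mk' (fun u => -WithZero.log (v (u.toMul : K))) fun x y => by
    rw [toMul_add, Units.val_mul, map_mul, WithZero.log_mul (by simp) (by simp), neg_add]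

theorem Valuation.order_nonneg_iff {K : Type*} [Field K]
    (v : Valuation K (WithZero (Multiplicative ℤ))) (u : Additive Kˣ) :
    0 ≤ v.order u ↔ v (u.toMul : K) ≤ 1 := by
  change 0 ≤ -WithZero.log (v (u.toMul : K)) ↔ _
  rw [neg_nonneg, WithZero.log_le_iff_le_exp (by simp), WithZero.exp_zero]

/-- Finitely many discrete valuations detect integrality among the fractions with denominator
`c`. -/
theorem exists_finite_orders {R K : Type*} [CommRing R] [IsDomain R]
    [IsNoetherianRing R] [IsIntegrallyClosed R] [Field K] [Algebra R K] [IsFractionRing R K]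
    {c : Additive Kˣ} (hc : c ∈ integralUnits R K) :
    ∃ S : Set (Additive Kˣ →+ ℤ), S.Finite ∧
      (∀ w ∈ S, ∀ u ∈ integralUnits R K, 0 ≤ w u) ∧
      ∀ z, c + z ∈ integralUnits R K → (∀ w ∈ S, 0 ≤ w z) → z ∈ integralUnits R K := by
  obtain ⟨c', hc'⟩ := mem_integralUnits.mp hc
  have hcK : algebraMap R K c' ≠ 0 := hc' ▸ c.toMul.ne_zero
  have hc0 : c' ≠ 0 := fun h => hcK (by rw [h, map_zero])
  choose v hv hvz using fun p : associatedPrimes R (R ⧸ Ideal.span {c'}) =>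
    exists_valuation_of_mem_associatedPrimes K hc0 p.2
  have : Finite (associatedPrimes R (R ⧸ Ideal.span {c'})) :=
    associatedPrimes.finite R (R ⧸ Ideal.span {c'})
  refine ⟨Set.range fun p => (v p).order, Set.finite_range _, ?_, ?_⟩
  · rintro _ ⟨p, rfl⟩ u ⟨a, ha⟩
    rw [Valuation.order_nonneg_iff]
    exact (congrArg (v p) ha).symm.trans_le (hv p a)
  · rintro z ⟨e, he⟩ hz
    have hcz : algebraMap R K e = algebraMap R K c' * (z.toMul : K) := by
      rw [hc']; exact he
    by_contra hzR
    have he0 : Ideal.Quotient.mk (Ideal.span {c'}) e ≠ 0 := by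
      rw [Ne, Ideal.Quotient.eq_zero_iff_mem, Ideal.mem_span_singleton]
      rintro ⟨y, rfl⟩
      exact hzR ⟨y, mul_left_cancel₀ hcK (by rw [← map_mul]; exact hcz)⟩
    obtain ⟨p, hp, hle⟩ := exists_le_isAssociatedPrime_of_isNoetherianRing R _ he0
    obtain ⟨s, hs, a, ha⟩ := hvz ⟨p, hp⟩ z.toMul
      ((Valuation.order_nonneg_iff _ _).mp (hz _ ⟨⟨p, hp⟩, rfl⟩))
    refine hs (hle ?_)
    have : s * e = c' * a := by
      apply IsFractionRing.injective R K
      rw [map_mul, map_mul, ← ha, hcz]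
      ring
    rw [Submodule.mem_colon_singleton, Submodule.mem_bot, Algebra.smul_def]
    change Ideal.Quotient.mk _ s * Ideal.Quotient.mk _ e = 0
    rw [← map_mul, this, Ideal.Quotient.eq_zero_iff_mem, Ideal.mem_span_singleton]
    exact dvd_mul_right _ _

/-- If `b = d * l` is the mixed value of a semidefinite form with diagonal values `A` and `q`, then
`n * q` dominates `-l` as soon as `n ≥ A`. -/
theorem nonneg_mul_add_of_semidefinite {A b q l n d : ℤ}
    (h : ∀ j k : ℤ, 0 ≤ j ^ 2 * A + 2 * (j * k) * b + k ^ 2 * q)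
    (hd : 0 < d) (hl : d * l = b) (hn : 1 ≤ n) (hA : A ≤ n) : 0 ≤ n * q + l := by
  have hA0 : 0 ≤ A := by simpa using h 1 0
  have hq0 : 0 ≤ q := by simpa using h 0 1
  rcases hq0.eq_or_lt with rfl | hq
  · have hb : b = 0 := by
      by_contra hb
      have hb2 : 1 ≤ b ^ 2 := sq_pos_of_ne_zero hb
      have h1 := h 1 (-((A + 1) * b))
      nlinarith [mul_le_mul_of_nonneg_left hb2 (by omega : 0 ≤ A + 1)]
    have : l = 0 := by simpa [hd.ne', hb] using hl
    simp [this]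
  · have hb : b ^ 2 ≤ q * A := by
      have h1 := h q (-b)
      refine le_of_sub_nonneg (nonneg_of_mul_nonneg_right (a := q) ?_ hq)
      linarith [show q * (q * A - b ^ 2) = q ^ 2 * A + 2 * (q * -b) * b + (-b) ^ 2 * q by ring]
    have hnq : 0 ≤ n * q := by positivity
    have hbn : |b| ≤ n * q := by
      apply abs_le_of_sq_le_sq _ hnq
      calc b ^ 2 ≤ n * q * 1 := by nlinarith
        _ ≤ (n * q) ^ 2 := by
          rw [sq]
          exact mul_le_mul_of_nonneg_left (by nlinarith) hnq
    have : 0 ≤ d * (n * q + l) := by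
      nlinarith [neg_abs_le b]
    exact nonneg_of_mul_nonneg_right this hd

theorem exists_nsmul_add_mem_integralUnits {R K M N : Type*} [CommRing R] [IsDomain R]
    [IsNoetherianRing R] [IsIntegrallyClosed R] [Field K] [Algebra R K] [IsFractionRing R K]
    [AddCommGroup M] [AddCommGroup N] (P : N →+ M →+ Additive Kˣ) (φ : M →+ N)
    (hsym : ∀ m m', P (φ m) m' = P (φ m') m) (hint : ∀ m, P (φ m) m ∈ integralUnits R K)
    {α : N} {d : ℕ} (hd : 0 < d) {a : M} (ha : φ a = d • α) :
    ∃ n : ℕ, 1 ≤ n ∧ ∀ m, P (n • φ m + α) m ∈ integralUnits R K := by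
  obtain ⟨S, hS, hSint, hSz⟩ := exists_finite_orders (hint a)
  obtain ⟨B, hB⟩ := (hS.image fun w => (w (P (φ a) a)).toNat).bddAbove
  have hy (m : M) : d • P α m = P (φ a) m := by
    rw [ha, map_nsmul, AddMonoidHom.nsmul_apply]
  refine ⟨B + 1, by omega, fun m => hSz _ ?_ fun w hw => ?_⟩
  · refine mem_integralUnits_of_nsmul_mem (k := 2 * d) (by omega) ?_
    have key : (2 * d) • (P (φ a) a + P ((B + 1) • φ m + α) m) =
        P (φ (a + m)) (a + m) + (2 * d - 1) • P (φ a) a +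
          (2 * d * (B + 1) - 1) • P (φ m) m := by
      simp only [map_add, AddMonoidHom.add_apply, map_nsmul, AddMonoidHom.nsmul_apply, hsym m a,
        ← hy m]
      obtain ⟨d, rfl⟩ := Nat.exists_eq_succ_of_ne_zero hd.ne'
      have h1 : 2 * (d + 1) - 1 = 2 * d + 1 := by omega
      have h2 : 2 * (d + 1) * (B + 1) - 1 = 2 * d * (B + 1) + 2 * B + 1 := by
        rw [show 2 * (d + 1) * (B + 1) = 2 * d * (B + 1) + 2 * B + 1 + 1 by ring]
        rfl
      rw [Nat.succ_eq_add_one, h1, h2]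
      module
    rw [key]
    exact add_mem (add_mem (hint _) (nsmul_mem (hint _) _)) (nsmul_mem (hint _) _)
  · have hl : (d : ℤ) * w (P α m) = w (P (φ a) m) := by
      rw [← hy, map_nsmul, nsmul_eq_mul]
    have hform (j k : ℤ) : 0 ≤ j ^ 2 * w (P (φ a) a) + 2 * (j * k) * w (P (φ a) m) +
        k ^ 2 * w (P (φ m) m) := by
      have h := hSint w hw _ (hint (j • a + k • m))
      simp only [map_add, AddMonoidHom.add_apply, map_zsmul, AddMonoidHom.zsmul_apply, hsym m a,
        smul_eq_mul] at h
      linarith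
    have hbound : w (P (φ a) a) ≤ ((B + 1 : ℕ) : ℤ) := by
      have := hB (Set.mem_image_of_mem (fun w => (w (P (φ a) a)).toNat) hw)
      omega
    have := nonneg_mul_add_of_semidefinite hform (by exact_mod_cast hd) hl (by omega) hbound
    rwa [map_add, AddMonoidHom.add_apply, map_add, map_nsmul, AddMonoidHom.nsmul_apply, map_nsmul,
      nsmul_eq_mul]

theorem exists_nsmul_mem_range_of_injective {r : ℕ} (φ : (Fin r → ℤ) →+ (Fin r → ℤ))
    (hφ : ∀ m, φ m = 0 → m = 0) (α : Fin r → ℤ) : ∃ d : ℕ, 0 < d ∧ ∃ a, φ a = d • α := by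
  let M : Matrix (Fin r) (Fin r) ℤ := LinearMap.toMatrix' φ.toIntLinearMap
  have hM (m : Fin r → ℤ) : φ m = M.mulVec m := (LinearMap.toMatrix'_mulVec φ.toIntLinearMap m).symm
  have hdet : M.det ≠ 0 := fun h => by
    obtain ⟨m, hm, hm0⟩ := Matrix.exists_mulVec_eq_zero_iff.mpr h
    exact hm (hφ m ((hM m).trans hm0))
  refine ⟨(M.det ^ 2).toNat, by have := sq_pos_of_ne_zero hdet; omega,
    M.det • M.adjugate.mulVec α, ?_⟩
  rw [map_zsmul, hM, Matrix.mulVec_mulVec, Matrix.mul_adjugate, Matrix.smul_mulVec,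
    Matrix.one_mulVec, smul_smul, ← natCast_zsmul, Int.toNat_of_nonneg (sq_nonneg _), sq]

/-- The pairing `(α, m) ↦ 𝔛^α(β^m)`. -/
def periodPairing {G : Type*} [CommGroup G] {r : ℕ} (β : Fin r → Fin r → G) :
    (Fin r → ℤ) →+ (Fin r → ℤ) →+ Additive G :=
  AddMonoidHom.mk' (fun α => AddMonoidHom.mk'
      (fun m => Additive.ofMul (∏ i, (∏ j, (β j i) ^ (m j)) ^ (α i)))
      fun m m' => by
        simp only [Pi.add_apply, zpow_add, Finset.prod_mul_distrib, mul_zpow, ofMul_mul])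
    fun α α' => by
      refine AddMonoidHom.ext fun m => ?_
      simp only [Pi.add_apply, zpow_add, Finset.prod_mul_distrib, AddMonoidHom.mk'_apply,
        AddMonoidHom.add_apply, ofMul_mul]

/-- **Mumford's integrality lemma** (Lemme 2 of the paper).
`R` is a noetherian integrally closed domain, complete for the `I`-adic topology
defined by a radical ideal `I`, with fraction field `K`.  The periods are the
elements `β 1, …, β r` of `(Kˣ)^r`; for `m : Fin r → ℤ` the period `β^m` has
`i`-th component `∏ j, (β j i) ^ (m j)`, and the character `𝔛^α` evaluated at a
point `w : Fin r → Kˣ` is `∏ i, (w i) ^ (α i)`.  Given an additive polarization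
`φ` satisfying the symmetry condition (i) and the positivity condition (ii),
for every `α` there is an `n ≥ 1` such that `𝔛^{nφ(m)+α}(β^m)` is integral for
all `m`. -/
theorem stmt0 {R K : Type*} [CommRing R] [IsDomain R] [IsNoetherianRing R]
    [IsIntegrallyClosed R] [Field K] [Algebra R K] [IsFractionRing R K]
    (I : Ideal R) (hrad : I.IsRadical) [IsAdicComplete I R]
    (r : ℕ) (hr : 1 ≤ r) (β : Fin r → Fin r → Kˣ)
    (φ : (Fin r → ℤ) →+ (Fin r → ℤ))
    (hsym : ∀ m m' : Fin r → ℤ,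
      (∏ i, (∏ j, (β j i) ^ (m' j)) ^ (φ m i)) =
        (∏ i, (∏ j, (β j i) ^ (m j)) ^ (φ m' i)))
    (hpos : ∀ m : Fin r → ℤ, m ≠ 0 →
      ((∏ i, (∏ j, (β j i) ^ (m j)) ^ (φ m i) : Kˣ) : K) ∈
        algebraMap R K '' I) :
    ∀ α : Fin r → ℤ, ∃ n : ℕ, 1 ≤ n ∧ ∀ m : Fin r → ℤ,
      ((∏ i, (∏ j, (β j i) ^ (m j)) ^ ((n • φ m + α) i) : Kˣ) : K) ∈
        Set.range (algebraMap R K) := by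
  intro α
  have hI : I ≠ ⊤ := by
    rintro rfl
    have := IsAdicComplete.le_jacobson_bot (⊤ : Ideal R) (Submodule.mem_top (x := 1))
    simpa using Ideal.mem_jacobson_bot.mp this (-1)
  have hφ (m : Fin r → ℤ) (hm : φ m = 0) : m = 0 := by
    by_contra hm0
    obtain ⟨a, ha, ha'⟩ := hpos m hm0
    have h1 : algebraMap R K a = algebraMap R K 1 := by simpa [hm] using ha'
    exact hI ((Ideal.eq_top_iff_one I).mpr (IsFractionRing.injective R K h1 ▸ ha))
  obtain ⟨d, hd, a, ha⟩ := exists_nsmul_mem_range_of_injective φ hφ α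
  refine exists_nsmul_add_mem_integralUnits (periodPairing β) φ
    (fun m m' => congrArg Additive.ofMul (hsym m m')) (fun m => ?_) hd ha
  by_cases hm : m = 0
  · rw [hm, map_zero]
    exact zero_mem _
  · exact Set.image_subset_range _ _ (hpos m hm)
end

section
/- Fix integers 1 ≤ r ≤ d. Let R_σ = ℤ[Z₁,…,Z_r, Z_{r+1}^{±1},…,Z_d^{±1}] be the monoid algebra of ℕ^r × ℤ^{d−r} over ℤ, and let R_σ^∧ be the completion of R_σ with respect to the principal ideal generated by Z₁·Z₂·⋯·Z_r. Then R_σ^∧ is an integral domain which is integrally closed in its field of fractions (i.e. R_σ^∧ is a normal domain). -/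
/-- The ring `R_σ = ℤ[Z₁,…,Z_r, Z_{r+1}^{±1},…,Z_d^{±1}]`, realized as the monoid
algebra over `ℤ` of the additive monoid `ℕ^r × ℤ^{d-r}` (the variable `Z_i`
corresponds to the `i`-th standard basis vector). -/
noncomputable abbrev RSigma (r d : ℕ) : Type :=
  AddMonoidAlgebra ℤ ((Fin r → ℕ) × (Fin (d - r) → ℤ))

/-- The element `Z₁ ⋅ Z₂ ⋅ ⋯ ⋅ Z_r` of `R_σ`, i.e. the monomial whose exponent
vector is `(1,…,1)` on the `ℕ^r`-part and `0` on the `ℤ^{d-r}`-part. -/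
noncomputable def ZProd (r d : ℕ) : RSigma r d :=
  AddMonoidAlgebra.single ((fun _ => 1 : Fin r → ℕ), (0 : Fin (d - r) → ℤ)) 1

open scoped nonZeroDivisors

section AbstractCriterion

variable {S : Type*} [CommRing S]

theorem Prime.pow_dvd_of_dvd_mul_of_mem_nonZeroDivisors {p a b : S} (hp : Prime p)
    (hreg : p ∈ S⁰) (hb : ¬ p ∣ b) {n : ℕ} (h : p ^ n ∣ b * a) : p ^ n ∣ a := by
  induction n generalizing a with
  | zero => simp
  | succ n ih =>
    obtain ⟨a, rfl⟩ := (hp.dvd_or_dvd ((dvd_pow_self p n.succ_ne_zero).trans h)).resolve_left hb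
    obtain ⟨t, ht⟩ := h
    rw [pow_succ']
    refine mul_dvd_mul_left p (ih ⟨t, (mul_cancel_left_mem_nonZeroDivisors hreg).1 ?_⟩)
    rw [mul_left_comm, ht, pow_succ', mul_assoc]

/-- If `f = ∏ pᵢ` is a product of regular primes, and `S` is `f`-adically separated, then `S` is
`pᵢ`-adically separated as soon as this holds modulo every `pⱼ` with `j ≠ i`. -/
theorem eq_zero_of_forall_pow_dvd_of_prod {ι : Type*} [Fintype ι] {p : ι → S}
    (hp : ∀ i, Prime (p i)) (hreg : ∀ i, p i ∈ S⁰)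
    (hsep : ∀ x : S, (∀ n : ℕ, (∏ i, p i) ^ n ∣ x) → x = 0) {i : ι}
    (hndvd : ∀ j, j ≠ i → ¬ p i ∣ p j)
    (hmod : ∀ j, j ≠ i → ∀ x : S, (∀ n : ℕ, p i ^ n ∣ x) → p j ∣ x)
    {x : S} (hx : ∀ n : ℕ, p i ^ n ∣ x) : x = 0 := by
  classical
  have key (s : Finset ι) (x : S) (hx : ∀ n : ℕ, p i ^ n ∣ x) :
      ∃ y, x = (∏ j ∈ s, p j) * y ∧ ∀ n : ℕ, p i ^ n ∣ y := by
    induction s using Finset.induction_on generalizing x with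
    | empty => exact ⟨x, by simp, hx⟩
    | insert j s hj ih =>
      obtain ⟨y, rfl, hy⟩ := ih x hx
      obtain ⟨z, rfl⟩ : p j ∣ y := by
        by_cases h : j = i
        · simpa [h] using hy 1
        · exact hmod j h y hy
      refine ⟨z, by rw [Finset.prod_insert hj]; ring, fun n ↦ ?_⟩
      by_cases h : j = i
      · subst h
        obtain ⟨t, ht⟩ := hy (n + 1)
        exact ⟨t, (mul_cancel_left_mem_nonZeroDivisors (hreg j)).1 (by rw [ht]; ring)⟩
      · exact (hp i).pow_dvd_of_dvd_mul_of_mem_nonZeroDivisors (hreg i) (hndvd j h) (hy n)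
  refine hsep x fun n ↦ ?_
  induction n generalizing x with
  | zero => simp
  | succ n ih =>
    obtain ⟨y, rfl, hy⟩ := key Finset.univ x hx
    rw [pow_succ']
    exact mul_dvd_mul_left _ (ih hy)

theorem FiniteMultiplicity.of_forall_pow_dvd_imp_eq_zero {p : S}
    (hsep : ∀ x : S, (∀ n : ℕ, p ^ n ∣ x) → x = 0) {x : S} (hx : x ≠ 0) :
    FiniteMultiplicity p x := by
  by_contra h
  refine hx (hsep x fun n ↦ ?_)
  exact (pow_dvd_pow p n.le_succ).trans (not_not.1 (not_exists.1 h n))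

theorem isDomain_of_prime_of_forall_pow_dvd_imp_eq_zero {p : S} (hp : Prime p) (hreg : p ∈ S⁰)
    (hsep : ∀ x : S, (∀ n : ℕ, p ^ n ∣ x) → x = 0) : IsDomain S := by
  have : Nontrivial S := ⟨p, 0, hp.ne_zero⟩
  have : NoZeroDivisors S := by
    refine ⟨fun {a b} hab ↦ ?_⟩
    by_contra! h
    obtain ⟨a', ha, ha'⟩ :=
      (FiniteMultiplicity.of_forall_pow_dvd_imp_eq_zero hsep h.1).exists_eq_pow_mul_and_not_dvd
    obtain ⟨b', hb, hb'⟩ :=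
      (FiniteMultiplicity.of_forall_pow_dvd_imp_eq_zero hsep h.2).exists_eq_pow_mul_and_not_dvd
    have h0 : a' * b' = 0 := by
      refine (mul_left_mem_nonZeroDivisors_eq_zero_iff
        (pow_mem hreg (multiplicity p a + multiplicity p b))).1 ?_
      calc _ = (p ^ multiplicity p a * a') * (p ^ multiplicity p b * b') := by ring
        _ = 0 := by rw [← ha, ← hb, hab]
    exact (hp.dvd_or_dvd (h0 ▸ dvd_zero p)).elim ha' hb'
  exact NoZeroDivisors.to_isDomain S

/-- The fraction `a / b` is almost integral, phrased without reference to a fraction field. -/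
def IsAlmostIntegralFraction (a b : S) : Prop :=
  ∃ c : S, c ≠ 0 ∧ ∀ n : ℕ, b ^ n ∣ c * a ^ n

namespace IsAlmostIntegralFraction

theorem dvd_of_isIntegrallyClosed [IsDomain S] [IsNoetherianRing S] [IsIntegrallyClosed S]
    {a b : S} (hb : b ≠ 0) (h : IsAlmostIntegralFraction a b) : b ∣ a := by
  let K := FractionRing S
  have hbK : algebraMap S K b ≠ 0 := by simpa using hb
  obtain ⟨c, hc, h⟩ := h
  have hx : IsAlmostIntegral S (algebraMap S K a / algebraMap S K b) := by
    refine ⟨c, mem_nonZeroDivisors_of_ne_zero hc, fun n ↦ ?_⟩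
    obtain ⟨t, ht⟩ := h n
    refine ⟨t, ?_⟩
    rw [Algebra.smul_def, div_pow, ← mul_div_assoc, eq_div_iff (pow_ne_zero n hbK)]
    simp only [← map_pow, ← map_mul, ht, mul_comm]
  obtain ⟨y, hy⟩ := IsIntegrallyClosed.isIntegral_iff.1 hx.isIntegral
  rw [eq_div_iff hbK, ← map_mul] at hy
  exact ⟨y, by rw [← IsFractionRing.injective S K hy, mul_comm]⟩

theorem isIntegrallyClosed [IsDomain S]
    (H : ∀ a b : S, b ≠ 0 → IsAlmostIntegralFraction a b → b ∣ a) : IsIntegrallyClosed S := by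
  let K := FractionRing S
  refine (isIntegrallyClosed_iff K).2 fun {x} hx ↦ ?_
  obtain ⟨c, hc, h⟩ := hx.isAlmostIntegral
  obtain ⟨a, b, hb, rfl⟩ := IsFractionRing.div_surjective (A := S) x
  have hb0 := nonZeroDivisors.ne_zero hb
  have hbK : algebraMap S K b ≠ 0 := by simpa using hb0
  obtain ⟨y, rfl⟩ := H a b hb0 ⟨c, nonZeroDivisors.ne_zero hc, fun n ↦ by
    obtain ⟨t, ht⟩ := h n
    rw [Algebra.smul_def, div_pow, ← mul_div_assoc, eq_div_iff (pow_ne_zero n hbK)] at ht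
    simp only [← map_pow, ← map_mul] at ht
    exact ⟨t, by rw [← IsFractionRing.injective S K ht, mul_comm]⟩⟩
  exact ⟨y, by rw [map_mul, mul_div_cancel_left₀ _ hbK]⟩

theorem sub_mul {a b : S} (h : IsAlmostIntegralFraction a b) (q : S) :
    IsAlmostIntegralFraction (a - b * q) b := by
  obtain ⟨c, hc, h⟩ := h
  refine ⟨c, hc, fun n ↦ ?_⟩
  rw [sub_eq_add_neg, add_pow, Finset.mul_sum]
  refine Finset.dvd_sum fun i hi ↦ ?_
  obtain ⟨t, ht⟩ := h i
  have hin : i + (n - i) = n := Nat.add_sub_cancel' (Finset.mem_range_succ_iff.1 hi)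
  refine ⟨t * (-q) ^ (n - i) * (n.choose i : S), ?_⟩
  calc c * (a ^ i * (-(b * q)) ^ (n - i) * (n.choose i : S))
      = (c * a ^ i) * (b ^ (n - i) * (-q) ^ (n - i)) * (n.choose i : S) := by
        rw [← mul_pow, mul_neg]; ring
    _ = b ^ (i + (n - i)) * (t * (-q) ^ (n - i) * (n.choose i : S)) := by
        rw [ht, pow_add]; ring
    _ = _ := by rw [hin]

variable [IsDomain S] {p : S}

theorem of_mul_left (hp : Prime p) {a b : S} (hb : ¬ p ∣ b)
    (h : IsAlmostIntegralFraction (p * a) b) : IsAlmostIntegralFraction a b := by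
  obtain ⟨c, hc, h⟩ := h
  refine ⟨c, hc, fun n ↦ ?_⟩
  obtain ⟨t, ht⟩ := h n
  obtain ⟨t, rfl⟩ : p ^ n ∣ t :=
    hp.pow_dvd_of_dvd_mul_left n (fun h ↦ hb (hp.dvd_of_dvd_pow h)) (a := b ^ n)
      ⟨c * a ^ n, by rw [← ht]; ring⟩
  exact ⟨t, mul_left_cancel₀ (pow_ne_zero n hp.ne_zero) (by linear_combination ht)⟩

theorem of_mul_mul (hp : p ≠ 0) {a b : S} (h : IsAlmostIntegralFraction (p * a) (p * b)) :
    IsAlmostIntegralFraction a b := by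
  obtain ⟨c, hc, h⟩ := h
  refine ⟨c, hc, fun n ↦ ?_⟩
  obtain ⟨t, ht⟩ := h n
  exact ⟨t, mul_left_cancel₀ (pow_ne_zero n hp) (by linear_combination ht)⟩

theorem dvd_of_dvd (hp : Prime p) (hsep : ∀ x : S, (∀ n : ℕ, p ^ n ∣ x) → x = 0) {a b : S}
    (h : IsAlmostIntegralFraction a b) (hb : p ∣ b) : p ∣ a := by
  obtain ⟨c, hc, h⟩ := h
  by_contra ha
  refine hc (hsep c fun n ↦ ?_)
  exact hp.pow_dvd_of_dvd_mul_right n (fun h ↦ ha (hp.dvd_of_dvd_pow h))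
    ((pow_dvd_pow_of_dvd hb n).trans (h n))

theorem exists_not_dvd (hp : Prime p) (hsep : ∀ x : S, (∀ n : ℕ, p ^ n ∣ x) → x = 0) {a b : S}
    (h : IsAlmostIntegralFraction a b) (hb : ¬ p ∣ b) :
    ∃ c : S, ¬ p ∣ c ∧ ∀ n : ℕ, b ^ n ∣ c * a ^ n := by
  obtain ⟨c, hc, h⟩ := h
  obtain ⟨c', hc, hc'⟩ :=
    (FiniteMultiplicity.of_forall_pow_dvd_imp_eq_zero hsep hc).exists_eq_pow_mul_and_not_dvd
  generalize multiplicity p c = k at hc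
  subst hc
  refine ⟨c', hc', fun n ↦ ?_⟩
  obtain ⟨t, ht⟩ := h n
  obtain ⟨t, rfl⟩ : p ^ k ∣ t :=
    hp.pow_dvd_of_dvd_mul_left k (fun h ↦ hb (hp.dvd_of_dvd_pow h)) (a := b ^ n)
      ⟨c' * a ^ n, by rw [← ht]; ring⟩
  exact ⟨t, mul_left_cancel₀ (pow_ne_zero k hp.ne_zero) (by linear_combination ht)⟩

variable {B : Type*} [CommRing B] [IsDomain B] [IsNoetherianRing B] [IsIntegrallyClosed B]

/-- One step of division with remainder modulo a prime `p` with normal residue ring `B`. -/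
theorem exists_eq_mul_add_mul (hp : Prime p) (hsep : ∀ x : S, (∀ n : ℕ, p ^ n ∣ x) → x = 0)
    {φ : S →+* B} (hφ : Function.Surjective φ) (hker : ∀ x, φ x = 0 ↔ p ∣ x) {a b : S}
    (h : IsAlmostIntegralFraction a b) (hb : ¬ p ∣ b) :
    ∃ q a' : S, a = b * q + p * a' ∧ IsAlmostIntegralFraction a' b := by
  obtain ⟨c, hc, hc'⟩ := h.exists_not_dvd hp hsep hb
  have : φ b ∣ φ a := dvd_of_isIntegrallyClosed ((hker b).not.2 hb)
    ⟨φ c, (hker c).not.2 hc, fun n ↦ by simpa using map_dvd φ (hc' n)⟩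
  obtain ⟨q, hq⟩ := this
  obtain ⟨q, rfl⟩ := hφ q
  obtain ⟨a', ha'⟩ : p ∣ a - b * q := by rw [← hker]; simp [hq]
  exact ⟨q, a', by rw [← ha']; ring, of_mul_left hp hb (ha' ▸ h.sub_mul q)⟩

end IsAlmostIntegralFraction

/-- Let `S` be complete for the `f`-adic topology, where `f = ∏ pᵢ` is regular and each `S / pᵢ` is
a Noetherian normal domain `Bᵢ`. If `pⱼ` is neither zero nor a unit modulo `pᵢ` for `i ≠ j`, then
`S` is a normal domain. -/
theorem isDomain_and_isIntegrallyClosed_of_isAdicComplete {ι : Type*} [Fintype ι] [Nonempty ι]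
    {p : ι → S} (hreg : ∏ i, p i ∈ S⁰) [IsAdicComplete (Ideal.span {∏ i, p i}) S]
    {B : ι → Type*} [∀ i, CommRing (B i)] [∀ i, IsDomain (B i)] [∀ i, IsNoetherianRing (B i)]
    [∀ i, IsIntegrallyClosed (B i)] {φ : ∀ i, S →+* B i} (hφ : ∀ i, Function.Surjective (φ i))
    (hker : ∀ i x, φ i x = 0 ↔ p i ∣ x) (hne : ∀ i j, i ≠ j → φ i (p j) ≠ 0)
    (hnu : ∀ i j, i ≠ j → ¬ IsUnit (φ i (p j))) :
    IsDomain S ∧ IsIntegrallyClosed S := by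
  classical
  have : Nontrivial S := (φ (Classical.arbitrary ι)).domain_nontrivial
  set f := ∏ i, p i with hf
  have hpreg (i : ι) : p i ∈ S⁰ := by
    rw [hf, ← Finset.mul_prod_erase _ _ (Finset.mem_univ i)] at hreg
    exact (mul_mem_nonZeroDivisors.1 hreg).1
  have hp (i : ι) : Prime (p i) := by
    refine ⟨nonZeroDivisors.ne_zero (hpreg i), fun h ↦ ?_, fun a b h ↦ ?_⟩
    · exact one_ne_zero (((hker i 1).2 h.dvd).symm.trans (map_one _)).symm
    · simpa only [← hker, map_mul, mul_eq_zero] using h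
  have hsep (x : S) (hx : ∀ n : ℕ, f ^ n ∣ x) : x = 0 := by
    refine IsHausdorff.haus (I := Ideal.span {f}) inferInstance x fun n ↦ ?_
    simpa [SModEq.zero, Ideal.span_singleton_pow, Ideal.mem_span_singleton] using hx n
  have hpsep (i : ι) (x : S) (hx : ∀ n : ℕ, p i ^ n ∣ x) : x = 0 := by
    refine eq_zero_of_forall_pow_dvd_of_prod hp hpreg hsep (i := i)
      (fun j hj ↦ by rw [← hker]; exact hne i j hj.symm) (fun j hj x hx ↦ ?_) hx
    rw [← hker]
    refine (IsHausdorff.of_isDomain (Ideal.span {φ j (p i)})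
      (by rw [Ne, Ideal.span_singleton_eq_top]; exact hnu j i hj)).haus _ fun n ↦ ?_
    simpa [SModEq.zero, Ideal.span_singleton_pow, Ideal.mem_span_singleton]
      using map_dvd (φ j) (hx n)
  have : IsDomain S := isDomain_of_prime_of_forall_pow_dvd_imp_eq_zero
    (hp (Classical.arbitrary ι)) (hpreg _) (hpsep _)
  have hstep (s : Finset ι) (a b : S) (hb : ∀ i, ¬ p i ∣ b) (h : IsAlmostIntegralFraction a b) :
      ∃ q a' : S, a = b * q + (∏ i ∈ s, p i) * a' ∧ IsAlmostIntegralFraction a' b := by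
    induction s using Finset.induction_on with
    | empty => exact ⟨0, a, by simp, h⟩
    | insert i s hi ih =>
      obtain ⟨q, a', rfl, ha'⟩ := ih
      obtain ⟨q', a'', rfl, ha''⟩ :=
        ha'.exists_eq_mul_add_mul (hp i) (hpsep i) (hφ i) (hker i) (hb i)
      exact ⟨q + (∏ j ∈ s, p j) * q', a'', by rw [Finset.prod_insert hi]; ring, ha''⟩
  have hcoprime (a b : S) (hb : ∀ i, ¬ p i ∣ b) (h : IsAlmostIntegralFraction a b) : b ∣ a := by
    choose q r hqr hr using fun x : {x : S // IsAlmostIntegralFraction x b} ↦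
      hstep Finset.univ x b hb x.2
    rw [← hf] at hqr
    let u : ℕ → {x : S // IsAlmostIntegralFraction x b} :=
      fun n ↦ (fun x ↦ ⟨r x, hr x⟩)^[n] ⟨a, h⟩
    have hu (n : ℕ) : (u n : S) = b * q (u n) + f * u (n + 1) := by
      simp only [u, Function.iterate_succ_apply']
      exact hqr _
    let Q : ℕ → S := fun n ↦ ∑ k ∈ Finset.range n, f ^ k * q (u k)
    have hQ (n : ℕ) : a = b * Q n + f ^ n * u n := by
      induction n with
      | zero => simp [Q, u]
      | succ n ih =>
        calc a = b * Q n + f ^ n * u n := ih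
          _ = b * Q (n + 1) + f ^ (n + 1) * u (n + 1) := by
            rw [hu n]; simp only [Q, Finset.sum_range_succ]; ring
    obtain ⟨L, hL⟩ := IsPrecomplete.prec (I := Ideal.span {f}) inferInstance (f := Q)
      fun {m n} hmn ↦ by
        rw [SModEq.comm, SModEq.sub_mem]
        simp only [smul_eq_mul, Ideal.mul_top, Ideal.span_singleton_pow, Ideal.mem_span_singleton]
        obtain ⟨k, rfl⟩ := Nat.exists_eq_add_of_le hmn
        simp only [Q, Finset.sum_range_add, add_sub_cancel_left]
        exact Finset.dvd_sum fun i _ ↦ by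
          rw [pow_add, mul_assoc]; exact dvd_mul_right _ _
    refine ⟨L, sub_eq_zero.1 (hsep _ fun n ↦ ?_)⟩
    have hLn := hL n
    simp only [SModEq.sub_mem, smul_eq_mul, Ideal.mul_top, Ideal.span_singleton_pow,
      Ideal.mem_span_singleton] at hLn
    obtain ⟨t, ht⟩ := hLn
    exact ⟨b * t + u n, by linear_combination hQ n + b * ht⟩
  refine ⟨this, IsAlmostIntegralFraction.isIntegrallyClosed ?_⟩
  have hdvd (s : Finset ι) (a b : S) (hb0 : b ≠ 0) (hb : ∀ i ∉ s, ¬ p i ∣ b)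
      (h : IsAlmostIntegralFraction a b) : b ∣ a := by
    induction s using Finset.induction_on generalizing a b with
    | empty => exact hcoprime a b (by simpa using hb) h
    | insert i s hi ih =>
      obtain ⟨b', hbb', hb'⟩ := (FiniteMultiplicity.of_forall_pow_dvd_imp_eq_zero
        (hpsep i) hb0).exists_eq_pow_mul_and_not_dvd
      generalize multiplicity (p i) b = k at hbb'
      subst hbb'
      induction k generalizing a with
      | zero =>
        rw [pow_zero, one_mul] at *
        refine ih a b' hb0 (fun j hj ↦ ?_) h
        by_cases hji : j = i
        · exact hji ▸ hb'
        · exact hb j (by simp [hji, hj])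
      | succ k ihk =>
        obtain ⟨a, rfl⟩ := h.dvd_of_dvd (hp i) (hpsep i)
          ((dvd_pow_self _ k.succ_ne_zero).trans (dvd_mul_right _ _))
        rw [pow_succ', mul_assoc] at *
        exact mul_dvd_mul_left _ (ihk a (right_ne_zero_of_mul hb0)
          (fun j hj hd ↦ hb j hj (hd.mul_left _)) (h.of_mul_mul (hp i).ne_zero))
  exact fun a b hb0 h ↦ hdvd Finset.univ a b hb0 (by simp) h

end AbstractCriterion

section MonoidAlgebra

/-- Splitting off the `i`-th coordinate of a tuple, as an additive equivalence. -/
def Fin.removeNthAddEquiv (A : Type*) [AddCommMonoid A] {n : ℕ} (i : Fin (n + 1)) :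
    (Fin (n + 1) → A) ≃+ A × (Fin n → A) where
  toFun m := (m i, i.removeNth m)
  invFun m := i.insertNth m.1 m.2
  left_inv m := by simp
  right_inv m := by simp
  map_add' _ _ := rfl

/-- Being a Noetherian normal domain. -/
structure IsNoetherianNormalDomain (A : Type*) [CommRing A] : Prop where
  isDomain : IsDomain A
  isNoetherianRing : IsNoetherianRing A
  isIntegrallyClosed : IsIntegrallyClosed A

namespace IsNoetherianNormalDomain

variable {A : Type*} [CommRing A]

theorem of_ringEquiv {B : Type*} [CommRing B] (h : IsNoetherianNormalDomain A) (e : A ≃+* B) :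
    IsNoetherianNormalDomain B :=
  have := h.isDomain
  have := h.isNoetherianRing
  have := h.isIntegrallyClosed
  ⟨e.symm.toMulEquiv.isDomain A, isNoetherianRing_of_ringEquiv A e, .of_equiv e⟩

theorem polynomial (h : IsNoetherianNormalDomain A) :
    IsNoetherianNormalDomain (Polynomial A) :=
  have := h.isDomain
  have := h.isNoetherianRing
  have := h.isIntegrallyClosed
  ⟨inferInstance, inferInstance, inferInstance⟩

theorem laurentPolynomial (h : IsNoetherianNormalDomain A) :
    IsNoetherianNormalDomain (LaurentPolynomial A) :=
  have := h.isDomain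
  have := h.isNoetherianRing
  have := h.isIntegrallyClosed
  have hX : Submonoid.powers (Polynomial.X : Polynomial A) ≤ (Polynomial A)⁰ :=
    powers_le_nonZeroDivisors_of_noZeroDivisors Polynomial.X_ne_zero
  ⟨IsLocalization.isDomain_of_le_nonZeroDivisors _ hX,
    IsLocalization.isNoetherianRing (.powers (Polynomial.X : Polynomial A)) _ inferInstance,
    isIntegrallyClosed_of_isLocalization _ _ hX⟩

theorem addMonoidAlgebra_nat (h : IsNoetherianNormalDomain A) (a : ℕ) :
    IsNoetherianNormalDomain (AddMonoidAlgebra A (Fin a → ℕ)) := by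
  induction a with
  | zero => exact h.of_ringEquiv (AddMonoidAlgebra.uniqueRingEquiv _).symm
  | succ a ih =>
    exact ih.polynomial.of_ringEquiv ((Polynomial.toFinsuppIso _).trans
      (AddMonoidAlgebra.curryRingEquiv.symm.trans
        (AddMonoidAlgebra.domCongr A A (Fin.removeNthAddEquiv ℕ 0)).symm.toRingEquiv))

theorem addMonoidAlgebra_int (h : IsNoetherianNormalDomain A) (b : ℕ) :
    IsNoetherianNormalDomain (AddMonoidAlgebra A (Fin b → ℤ)) := by
  induction b with
  | zero => exact h.of_ringEquiv (AddMonoidAlgebra.uniqueRingEquiv _).symm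
  | succ b ih =>
    exact ih.laurentPolynomial.of_ringEquiv (AddMonoidAlgebra.curryRingEquiv.symm.trans
        (AddMonoidAlgebra.domCongr A A (Fin.removeNthAddEquiv ℤ 0)).symm.toRingEquiv)

theorem addMonoidAlgebra (h : IsNoetherianNormalDomain A) (a b : ℕ) :
    IsNoetherianNormalDomain (AddMonoidAlgebra A ((Fin a → ℕ) × (Fin b → ℤ))) :=
  ((h.addMonoidAlgebra_int b).addMonoidAlgebra_nat a).of_ringEquiv
    AddMonoidAlgebra.curryRingEquiv.symm

end IsNoetherianNormalDomain

namespace AddMonoidAlgebra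

variable (A : Type*) [CommRing A] (G : Type*) [AddCommMonoid G]

/-- The variable attached to the `i`-th coordinate of `ℕ ^ n`. -/
noncomputable def coordVar {n : ℕ} (i : Fin n) : AddMonoidAlgebra A ((Fin n → ℕ) × G) :=
  single (Pi.single i 1, 0) 1

/-- The monoid algebra of `ℕ ^ (n + 1) × G` is a polynomial ring in its `i`-th variable. -/
noncomputable def polynomialRingEquiv {n : ℕ} (i : Fin (n + 1)) :
    AddMonoidAlgebra A ((Fin (n + 1) → ℕ) × G) ≃+*
      Polynomial (AddMonoidAlgebra A ((Fin n → ℕ) × G)) :=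
  (domCongr A A (((Fin.removeNthAddEquiv ℕ i).prodCongr (.refl G)).trans
    .prodAssoc)).toRingEquiv.trans
    (curryRingEquiv.trans (Polynomial.toFinsuppIso _).symm)

variable {A G}

theorem polynomialRingEquiv_single {n : ℕ} (i : Fin (n + 1)) (m : Fin (n + 1) → ℕ) (g : G)
    (a : A) : polynomialRingEquiv A G i (single (m, g) a) =
      Polynomial.monomial (m i) (single (i.removeNth m, g) a) := by
  simp [polynomialRingEquiv, AddEquiv.prodAssoc]
  rfl

theorem polynomialRingEquiv_coordVar_self {n : ℕ} (i : Fin (n + 1)) :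
    polynomialRingEquiv A G i (coordVar A G i) = Polynomial.X := by
  have : i.removeNth (Pi.single i 1 : Fin (n + 1) → ℕ) = 0 := by
    ext k; simp [Fin.removeNth]
  rw [coordVar, polynomialRingEquiv_single, this, Pi.single_eq_same, Polynomial.X]
  rfl

theorem polynomialRingEquiv_coordVar_succAbove {n : ℕ} (i : Fin (n + 1)) (k : Fin n) :
    polynomialRingEquiv A G i (coordVar A G (i.succAbove k)) = Polynomial.C (coordVar A G k) := by
  have : i.removeNth (Pi.single (i.succAbove k) 1 : Fin (n + 1) → ℕ) = Pi.single k 1 := by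
    ext l; simp [Fin.removeNth, Pi.single_apply]
  rw [coordVar, polynomialRingEquiv_single, this, Pi.single_eq_of_ne (Fin.succAbove_ne i k).symm,
    Polynomial.monomial_zero_left, coordVar]

variable (A G) in
/-- Setting the `i`-th variable to zero. -/
noncomputable def killCoord {n : ℕ} (i : Fin (n + 1)) :
    AddMonoidAlgebra A ((Fin (n + 1) → ℕ) × G) →+* AddMonoidAlgebra A ((Fin n → ℕ) × G) :=
  Polynomial.constantCoeff.comp (polynomialRingEquiv A G i).toRingHom

theorem killCoord_surjective {n : ℕ} (i : Fin (n + 1)) :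
    Function.Surjective (killCoord A G i) :=
  Polynomial.constantCoeff_surjective.comp (polynomialRingEquiv A G i).surjective

theorem killCoord_eq_zero_iff {n : ℕ} (i : Fin (n + 1))
    (x : AddMonoidAlgebra A ((Fin (n + 1) → ℕ) × G)) :
    killCoord A G i x = 0 ↔ coordVar A G i ∣ x := by
  rw [← map_dvd_iff (polynomialRingEquiv A G i), polynomialRingEquiv_coordVar_self,
    Polynomial.X_dvd_iff]
  rfl

theorem killCoord_coordVar_succAbove {n : ℕ} (i : Fin (n + 1)) (k : Fin n) :
    killCoord A G i (coordVar A G (i.succAbove k)) = coordVar A G k := by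
  simp [killCoord, polynomialRingEquiv_coordVar_succAbove]

theorem coordVar_ne_zero [Nontrivial A] {n : ℕ} (i : Fin n) : coordVar A G i ≠ 0 := by
  simp [coordVar]

theorem not_isUnit_coordVar [Nontrivial A] {n : ℕ} (i : Fin n) : ¬ IsUnit (coordVar A G i) := by
  obtain _ | n := n
  · exact i.elim0
  · intro h
    have h0 := (killCoord_eq_zero_iff i _).2 (dvd_refl (coordVar A G i))
    exact not_isUnit_zero (h0 ▸ h.map (killCoord A G i))

end AddMonoidAlgebra

end MonoidAlgebra

section AdicCompletion

theorem algebraMap_adicCompletion_mem_nonZeroDivisors {R : Type*} [CommRing R]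
    [IsNoetherianRing R] (I : Ideal R) {f : R} (hf : f ∈ R⁰) :
    algebraMap R (AdicCompletion I R) f ∈ (AdicCompletion I R)⁰ := by
  have h : IsSMulRegular (AdicCompletion I R) f := Module.Flat.isSMulRegular_of_nonZeroDivisors hf
  refine mem_nonZeroDivisors_iff_right.2 fun x hx ↦ h ?_
  simp only [smul_zero]
  rw [Algebra.smul_def, mul_comm, hx]

theorem AdicCompletion.isAdicComplete_span_algebraMap {R : Type*} [CommRing R] (f : R) :
    IsAdicComplete (Ideal.span {algebraMap R (AdicCompletion (Ideal.span {f}) R) f})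
      (AdicCompletion (Ideal.span {f}) R) := by
  rw [← Set.image_singleton, ← Ideal.map_span, IsAdicComplete.map_algebraMap_iff]
  exact isAdicComplete (Submodule.fg_span_singleton f)

/-- If `φ : R → B` kills `f` and its kernel is generated by a divisor `p` of `f`, then `φ` extends
to the `f`-adic completion of `R`, with kernel generated by `p`. -/
theorem AdicCompletion.exists_ringHom_of_dvd {R B : Type*} [CommRing R] [CommRing B] {f p : R}
    (hpf : p ∣ f) {φ : R →+* B} (hφ : Function.Surjective φ) (hker : ∀ x, φ x = 0 ↔ p ∣ x) :
    ∃ ψ : AdicCompletion (Ideal.span {f}) R →+* B, Function.Surjective ψ ∧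
      (∀ x, ψ (algebraMap R _ x) = φ x) ∧ ∀ x, ψ x = 0 ↔ algebraMap R _ p ∣ x := by
  have hlift : ∀ x ∈ Ideal.span {f}, φ x = 0 := fun x hx ↦
    (hker x).2 (hpf.trans (Ideal.mem_span_singleton.1 hx))
  let ψ := (Ideal.Quotient.lift _ φ hlift).comp (evalOneₐ (Ideal.span {f})).toRingHom
  have hψ (x : R) : ψ (algebraMap R _ x) = φ x := rfl
  refine ⟨ψ, (Ideal.Quotient.lift_surjective_of_surjective _ hlift hφ).comp
    (evalOneₐ_surjective _), hψ, fun x ↦ ⟨fun hx ↦ ?_, ?_⟩⟩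
  · obtain ⟨y, hy⟩ := Ideal.Quotient.mk_surjective (evalOneₐ (Ideal.span {f}) x)
    have hpy : p ∣ y := by
      rw [← hker, ← hx]
      change _ = Ideal.Quotient.lift _ φ hlift (evalOneₐ (Ideal.span {f}) x)
      rw [← hy, Ideal.Quotient.lift_mk]
    have hmem : x - algebraMap R _ y ∈ RingHom.ker (evalOneₐ (Ideal.span {f})).toRingHom := by
      rw [RingHom.mem_ker, map_sub, sub_eq_zero]
      exact hy.symm
    rw [ker_evalOneₐ_eq_map _ (Submodule.fg_span_singleton f), Ideal.map_span,
      Set.image_singleton, Ideal.mem_span_singleton] at hmem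
    exact (dvd_sub_left (map_dvd _ hpy)).1 ((map_dvd _ hpf).trans hmem)
  · rintro ⟨y, rfl⟩
    rw [map_mul, hψ, (hker p).2 dvd_rfl, zero_mul]

end AdicCompletion

theorem ZProd_eq_prod (r d : ℕ) :
    ZProd r d = ∏ i, AddMonoidAlgebra.coordVar ℤ (Fin (d - r) → ℤ) i := by
  have h : ((fun _ ↦ 1 : Fin r → ℕ), (0 : Fin (d - r) → ℤ)) =
      ∑ i, ((Pi.single i 1 : Fin r → ℕ), (0 : Fin (d - r) → ℤ)) := by
    ext
    · simp [Prod.fst_sum, Finset.sum_apply, Pi.single_apply]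
    · simp [Prod.snd_sum]
  rw [ZProd, h]
  have := map_prod (AddMonoidAlgebra.of ℤ ((Fin r → ℕ) × (Fin (d - r) → ℤ)))
    (fun i ↦ Multiplicative.ofAdd ((Pi.single i 1 : Fin r → ℕ), (0 : Fin (d - r) → ℤ))) Finset.univ
  rw [← ofAdd_sum] at this
  exact this

/-- The completion `R_σ^∧` of `R_σ` with respect to the principal ideal
generated by `Z₁ ⋯ Z_r` is a normal domain: it is an integral domain which is
integrally closed in its field of fractions. -/
theorem stmt1 (r d : ℕ) (hr : 1 ≤ r) (hd : r ≤ d) :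
    IsDomain (AdicCompletion (Ideal.span {ZProd r d}) (RSigma r d)) ∧
    IsIntegrallyClosed (AdicCompletion (Ideal.span {ZProd r d}) (RSigma r d)) := by
  obtain ⟨n, rfl⟩ : ∃ n, r = n + 1 := ⟨r - 1, by omega⟩
  have hint : IsNoetherianNormalDomain ℤ := ⟨inferInstance, inferInstance, inferInstance⟩
  have hR := hint.addMonoidAlgebra (n + 1) (d - (n + 1))
  have hB := hint.addMonoidAlgebra n (d - (n + 1))
  have := hR.isDomain
  have := hR.isNoetherianRing
  have := hB.isDomain
  have := hB.isNoetherianRing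
  have := hB.isIntegrallyClosed
  let Z (i : Fin (n + 1)) := AddMonoidAlgebra.coordVar ℤ (Fin (d - (n + 1)) → ℤ) i
  let ι := algebraMap (RSigma (n + 1) d)
    (AdicCompletion (Ideal.span {ZProd (n + 1) d}) (RSigma (n + 1) d))
  have hZ : ι (ZProd (n + 1) d) = ∏ i, ι (Z i) :=
    (congrArg ι (ZProd_eq_prod (n + 1) d)).trans (map_prod ι Z Finset.univ)
  have hcomplete : IsAdicComplete (Ideal.span {∏ i, ι (Z i)}) _ :=
    hZ ▸ AdicCompletion.isAdicComplete_span_algebraMap (ZProd (n + 1) d)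
  have hreg : ∏ i, ι (Z i) ∈ nonZeroDivisors _ :=
    hZ ▸ algebraMap_adicCompletion_mem_nonZeroDivisors _
      (mem_nonZeroDivisors_of_ne_zero (by simp [ZProd]))
  choose φ hφ hφι hker using fun i ↦ AdicCompletion.exists_ringHom_of_dvd (f := ZProd (n + 1) d)
    (ZProd_eq_prod (n + 1) d ▸ Finset.dvd_prod_of_mem Z (Finset.mem_univ i))
    (AddMonoidAlgebra.killCoord_surjective i) (AddMonoidAlgebra.killCoord_eq_zero_iff i)
  have hφZ (i j : Fin (n + 1)) (hij : i ≠ j) :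
      ∃ k, φ i (ι (Z j)) = AddMonoidAlgebra.coordVar ℤ _ k := by
    obtain ⟨k, rfl⟩ := Fin.exists_succAbove_eq hij.symm
    exact ⟨k, (hφι i _).trans (AddMonoidAlgebra.killCoord_coordVar_succAbove i k)⟩
  refine isDomain_and_isIntegrallyClosed_of_isAdicComplete hreg hφ hker
    (fun i j hij ↦ ?_) (fun i j hij ↦ ?_)
  · obtain ⟨k, hk⟩ := hφZ i j hij
    exact hk ▸ AddMonoidAlgebra.coordVar_ne_zero k
  · obtain ⟨k, hk⟩ := hφZ i j hij
    exact hk ▸ AddMonoidAlgebra.not_isUnit_coordVar k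
end

section
/- Let G⁺(𝔬⊕𝔠*) be the group of matrices (α β; γ δ) ∈ GL₂(F) with α ∈ 𝔬, β ∈ 𝔠*, γ ∈ 𝔠𝔡, δ ∈ 𝔬 and determinant in E, acting on nonzero column vectors of F² by left matrix multiplication, and let 𝔬^× act on F² ∖ {0} by scalar multiplication. Then the map sending a nonzero vector (a, c) ∈ F² ∖ {0} to the fractional ideal a𝔬 + c𝔠* is invariant under both actions and induces a bijection from the double quotient G⁺(𝔬⊕𝔠*) \ (F² ∖ {0}) / 𝔬^× onto the set ℐ_F of all nonzero fractional ideals of F. -/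
open NumberField FractionalIdeal
open scoped nonZeroDivisors

variable (F : Type*) [Field F] [NumberField F]

/-- The different ideal `𝔡` of `F`, as a fractional ideal. -/
noncomputable def diffF : FractionalIdeal (𝓞 F)⁰ F :=
  (differentIdeal ℤ (𝓞 F) : FractionalIdeal (𝓞 F)⁰ F)

/-- The group `G⁺(𝔬 ⊕ 𝔠*)` of matrices `(α β; γ δ) ∈ GL₂(F)` with `α ∈ 𝔬`,
`β ∈ 𝔠* = 𝔠⁻¹𝔡⁻¹`, `γ ∈ 𝔠𝔡`, `δ ∈ 𝔬` and determinant in `E`. -/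
noncomputable def GPlus (𝔠 : FractionalIdeal (𝓞 F)⁰ F) (E : Subgroup (𝓞 F)ˣ) :
    Set (Matrix (Fin 2) (Fin 2) F) :=
  {γ | γ 0 0 ∈ (1 : FractionalIdeal (𝓞 F)⁰ F) ∧
       γ 0 1 ∈ 𝔠⁻¹ * (diffF F)⁻¹ ∧
       γ 1 0 ∈ 𝔠 * diffF F ∧
       γ 1 1 ∈ (1 : FractionalIdeal (𝓞 F)⁰ F) ∧
       ∃ u ∈ E, ((u : 𝓞 F) : F) = γ.det}

/-- The fractional ideal `a𝔬 + c𝔠*` attached to a vector `(a, c) ∈ F²`. -/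
noncomputable def cuspIdeal (𝔠 : FractionalIdeal (𝓞 F)⁰ F) (v : Fin 2 → F) :
    FractionalIdeal (𝓞 F)⁰ F :=
  spanSingleton (𝓞 F)⁰ (v 0) + spanSingleton (𝓞 F)⁰ (v 1) * (𝔠⁻¹ * (diffF F)⁻¹)

namespace FractionalIdeal

variable {R K : Type*} [CommRing R] [Field K] [Algebra R K]

protected theorem add_mem {I : FractionalIdeal R⁰ K} {s t : K} (hs : s ∈ I) (ht : t ∈ I) :
    s + t ∈ I :=
  (I : Submodule R K).add_mem hs ht

protected theorem neg_mem {I : FractionalIdeal R⁰ K} {s : K} (hs : s ∈ I) : -s ∈ I :=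
  (I : Submodule R K).neg_mem hs

protected theorem sub_mem {I : FractionalIdeal R⁰ K} {s t : K} (hs : s ∈ I) (ht : t ∈ I) :
    s - t ∈ I :=
  (I : Submodule R K).sub_mem hs ht

theorem mul_mem_of_mem_one {I : FractionalIdeal R⁰ K} {s t : K}
    (hs : s ∈ (1 : FractionalIdeal R⁰ K)) (ht : t ∈ I) : s * t ∈ I := by
  simpa using mul_mem_mul hs ht

theorem exists_ne_zero_mem {I : FractionalIdeal R⁰ K} (hI : I ≠ 0) : ∃ t ∈ I, t ≠ 0 := by
  by_contra! h
  exact hI (eq_zero_iff.2 h)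

variable [IsFractionRing R K]

/-- The fractional ideal `a R + c I` attached to the vector `v = (a, c)`. -/
noncomputable def vecIdeal (I : FractionalIdeal R⁰ K) (v : Fin 2 → K) : FractionalIdeal R⁰ K :=
  spanSingleton R⁰ (v 0) + spanSingleton R⁰ (v 1) * I

theorem apply_zero_mem_vecIdeal (I : FractionalIdeal R⁰ K) (v : Fin 2 → K) :
    v 0 ∈ vecIdeal I v :=
  (mem_add _ _ _).2 ⟨_, mem_spanSingleton_self _ _, 0, zero_mem _, add_zero _⟩

theorem spanSingleton_apply_one_mul_le_vecIdeal (I : FractionalIdeal R⁰ K) (v : Fin 2 → K) :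
    spanSingleton R⁰ (v 1) * I ≤ vecIdeal I v :=
  le_add_of_nonneg_left (zero_le _)

theorem mul_mem_vecIdeal {I : FractionalIdeal R⁰ K} (v : Fin 2 → K) {t : K} (ht : t ∈ I) :
    v 1 * t ∈ vecIdeal I v :=
  spanSingleton_apply_one_mul_le_vecIdeal I v
    (mul_mem_mul (mem_spanSingleton_self _ _) ht)

theorem vecIdeal_le_iff {I J : FractionalIdeal R⁰ K} {v : Fin 2 → K} :
    vecIdeal I v ≤ J ↔ v 0 ∈ J ∧ ∀ t ∈ I, v 1 * t ∈ J := by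
  constructor
  · intro h
    exact ⟨h (apply_zero_mem_vecIdeal I v), fun t ht ↦ h (mul_mem_vecIdeal v ht)⟩
  · rintro ⟨h0, h1⟩
    rw [vecIdeal, ← sup_eq_add, sup_le_iff, spanSingleton_le_iff_mem, spanSingleton_mul_le_iff]
    exact ⟨h0, h1⟩

theorem vecIdeal_smul (I : FractionalIdeal R⁰ K) (x : K) (v : Fin 2 → K) :
    vecIdeal I (x • v) = spanSingleton R⁰ x * vecIdeal I v := by
  simp only [vecIdeal, Pi.smul_apply, smul_eq_mul, ← spanSingleton_mul_spanSingleton]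
  ring

theorem spanSingleton_unit (u : Rˣ) : spanSingleton R⁰ (algebraMap R K u) = 1 := by
  rw [← coeIdeal_span_singleton, Ideal.span_singleton_eq_top.2 u.isUnit, coeIdeal_top]

theorem vecIdeal_unit_smul (I : FractionalIdeal R⁰ K) (u : Rˣ) (v : Fin 2 → K) :
    vecIdeal I (algebraMap R K u • v) = vecIdeal I v := by
  rw [vecIdeal_smul, spanSingleton_unit, one_mul]

theorem vecIdeal_ne_zero {I : FractionalIdeal R⁰ K} (hI : I ≠ 0) {v : Fin 2 → K} (hv : v ≠ 0) :
    vecIdeal I v ≠ 0 := by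
  intro h
  obtain ⟨h0, h1⟩ := vecIdeal_le_iff.1 h.le
  obtain ⟨t, ht, ht0⟩ := exists_ne_zero_mem hI
  refine hv (funext fun i ↦ ?_)
  fin_cases i
  · simpa using h0
  · simpa [ht0] using h1 t ht

variable [IsDedekindDomain R]

theorem mul_mem_one_of_mem_inv {I : FractionalIdeal R⁰ K} (hI : I ≠ 0) {s t : K}
    (hs : s ∈ I⁻¹) (ht : t ∈ I) : s * t ∈ (1 : FractionalIdeal R⁰ K) := by
  simpa [inv_mul_cancel₀ hI] using mul_mem_mul hs ht

/-- The matrices `(α β; γ δ)` with `α, δ ∈ R`, `β ∈ I` and `γ ∈ I⁻¹`. -/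
def order (I : FractionalIdeal R⁰ K) : Set (Matrix (Fin 2) (Fin 2) K) :=
  {g | g 0 0 ∈ (1 : FractionalIdeal R⁰ K) ∧ g 0 1 ∈ I ∧ g 1 0 ∈ I⁻¹ ∧
    g 1 1 ∈ (1 : FractionalIdeal R⁰ K)}

theorem vecIdeal_mulVec_le {I : FractionalIdeal R⁰ K} (hI : I ≠ 0)
    {g : Matrix (Fin 2) (Fin 2) K} (hg : g ∈ order I) (v : Fin 2 → K) :
    vecIdeal I (g.mulVec v) ≤ vecIdeal I v := by
  obtain ⟨h00, h01, h10, h11⟩ := hg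
  simp only [vecIdeal_le_iff, Matrix.mulVec, dotProduct, Fin.sum_univ_two]
  refine ⟨FractionalIdeal.add_mem
    (mul_mem_of_mem_one h00 (apply_zero_mem_vecIdeal I v)) ?_, fun t ht ↦ ?_⟩
  · rw [mul_comm]
    exact mul_mem_vecIdeal v h01
  · have h : (g 1 0 * v 0 + g 1 1 * v 1) * t = g 1 0 * t * v 0 + v 1 * (g 1 1 * t) := by ring
    rw [h]
    exact FractionalIdeal.add_mem
      (mul_mem_of_mem_one (mul_mem_one_of_mem_inv hI h10 ht) (apply_zero_mem_vecIdeal I v))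
      (mul_mem_vecIdeal v (mul_mem_of_mem_one h11 ht))

theorem vecIdeal_mulVec {I : FractionalIdeal R⁰ K} (hI : I ≠ 0)
    {g : Matrix (Fin 2) (Fin 2) K} (hg : g ∈ order I) {u : Rˣ} (hu : algebraMap R K u = g.det)
    (v : Fin 2 → K) : vecIdeal I (g.mulVec v) = vecIdeal I v := by
  refine (vecIdeal_mulVec_le hI hg v).antisymm ?_
  have hadj : g.adjugate ∈ order I := by
    obtain ⟨h00, h01, h10, h11⟩ := hg
    simp only [order, Set.mem_ofPred_eq, Matrix.adjugate_fin_two, Matrix.of_apply,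
      Matrix.cons_val', Matrix.cons_val_zero, Matrix.cons_val_one, Matrix.cons_val_fin_one]
    exact ⟨h11, FractionalIdeal.neg_mem h01, FractionalIdeal.neg_mem h10, h00⟩
  have h := vecIdeal_mulVec_le hI hadj (g.mulVec v)
  rwa [Matrix.mulVec_mulVec, Matrix.adjugate_mul, Matrix.smul_mulVec, Matrix.one_mulVec, ← hu,
    vecIdeal_unit_smul] at h

theorem exists_spanSingleton_add_eq {I J : FractionalIdeal R⁰ K} (hI : I ≠ 0) (hIJ : I ≤ J) :
    ∃ a : K, spanSingleton R⁰ a + I = J := by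
  obtain ⟨d, J₀, hd, rfl⟩ := exists_eq_spanSingleton_mul J
  have hd' : algebraMap R K d ≠ 0 := by simpa using hd
  have hdd : spanSingleton R⁰ (algebraMap R K d)⁻¹ * spanSingleton R⁰ (algebraMap R K d) = 1 := by
    rw [spanSingleton_mul_spanSingleton, inv_mul_cancel₀ hd', spanSingleton_one]
  have hle : spanSingleton R⁰ (algebraMap R K d) * I ≤ J₀ := by
    have h := mul_le_mul_right hIJ (spanSingleton R⁰ (algebraMap R K d))
    rwa [← mul_assoc, mul_comm (spanSingleton R⁰ (algebraMap R K d)) (spanSingleton R⁰ _), hdd,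
      one_mul] at h
  obtain ⟨I₀, hI₀⟩ := le_one_iff_exists_coeIdeal.1 (hle.trans coeIdeal_le_one)
  have hI₀' : I₀ ≠ 0 := by
    rintro rfl
    refine mul_ne_zero (spanSingleton_ne_zero_iff.2 hd') hI ?_
    rw [← hI₀, Ideal.zero_eq_bot, coeIdeal_bot]
  rw [← hI₀, coeIdeal_le_coeIdeal] at hle
  obtain ⟨a, rfl⟩ := IsDedekindDomain.exists_sup_span_eq hle hI₀'
  refine ⟨(algebraMap R K d)⁻¹ * algebraMap R K a, ?_⟩
  rw [coeIdeal_sup, coeIdeal_span_singleton, hI₀, mul_add, ← mul_assoc, hdd, one_mul,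
    spanSingleton_mul_spanSingleton, add_comm]

theorem exists_vecIdeal_eq {I J : FractionalIdeal R⁰ K} (hI : I ≠ 0) (hJ : J ≠ 0) :
    ∃ v : Fin 2 → K, v ≠ 0 ∧ vecIdeal I v = J := by
  obtain ⟨c, hc, hc0⟩ := exists_ne_zero_mem (mul_ne_zero hJ (inv_ne_zero hI))
  have hle : spanSingleton R⁰ c * I ≤ J := by
    calc spanSingleton R⁰ c * I ≤ J * I⁻¹ * I :=
          mul_le_mul_left (spanSingleton_le_iff_mem.2 hc) I
      _ = J := by rw [mul_assoc, inv_mul_cancel₀ hI, mul_one]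
  obtain ⟨a, ha⟩ := exists_spanSingleton_add_eq
    (mul_ne_zero (spanSingleton_ne_zero_iff.2 hc0) hI) hle
  exact ⟨![a, c], fun h ↦ hc0 (congrFun h 1), ha⟩

/-- A nonzero vector can be completed to a matrix of determinant one whose second column has
entries in `I * J⁻¹` and `J⁻¹`, where `J` is the ideal of the vector. -/
theorem exists_mul_add_mul_eq_one {I : FractionalIdeal R⁰ K} (hI : I ≠ 0) {v : Fin 2 → K}
    (hv : v ≠ 0) : ∃ x ∈ (vecIdeal I v)⁻¹, ∃ y ∈ I * (vecIdeal I v)⁻¹,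
      v 0 * x + v 1 * y = 1 := by
  have h : (1 : K) ∈ vecIdeal I v * (vecIdeal I v)⁻¹ := by
    rw [mul_inv_cancel₀ (vecIdeal_ne_zero hI hv)]
    exact one_mem_one _
  nth_rw 1 [vecIdeal] at h
  rw [add_mul, mul_assoc, mem_add] at h
  obtain ⟨_, hy, _, hz, h⟩ := h
  obtain ⟨x, hx, rfl⟩ := mem_singleton_mul.1 hy
  obtain ⟨y, hy, rfl⟩ := mem_singleton_mul.1 hz
  exact ⟨x, hx, y, hy, h⟩

theorem apply_one_mem {I : FractionalIdeal R⁰ K} (hI : I ≠ 0) (v : Fin 2 → K) :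
    v 1 ∈ I⁻¹ * vecIdeal I v := by
  rw [← spanSingleton_le_iff_mem]
  calc spanSingleton R⁰ (v 1) = I⁻¹ * (spanSingleton R⁰ (v 1) * I) := by
        rw [mul_comm, mul_assoc, mul_inv_cancel₀ hI, mul_one]
    _ ≤ _ := mul_le_mul_right (spanSingleton_apply_one_mul_le_vecIdeal I v) _

theorem exists_mem_order_mulVec_eq {I : FractionalIdeal R⁰ K} (hI : I ≠ 0) {v w : Fin 2 → K}
    (hv : v ≠ 0) (hw : w ≠ 0) (h : vecIdeal I v = vecIdeal I w) :
    ∃ g ∈ order I, g.det = 1 ∧ g.mulVec v = w := by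
  obtain ⟨x, hx, y, hy, hxy⟩ := exists_mul_add_mul_eq_one hI hv
  obtain ⟨x', hx', y', hy', hxy'⟩ := exists_mul_add_mul_eq_one hI hw
  have ha := apply_zero_mem_vecIdeal I v
  have ha' := apply_zero_mem_vecIdeal I w
  have hc := apply_one_mem hI v
  have hc' := apply_one_mem hI w
  have hJ := vecIdeal_ne_zero hI hw
  rw [h] at hx hy ha hc
  set J := vecIdeal I w
  have e1 : J * J⁻¹ = 1 := mul_inv_cancel₀ hJ
  have e2 : I⁻¹ * J * (I * J⁻¹) = 1 := by
    rw [mul_mul_mul_comm, inv_mul_cancel₀ hI, e1, one_mul]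
  have e3 : J * (I * J⁻¹) = I := by rw [mul_left_comm, e1, mul_one]
  have e4 : I⁻¹ * J * J⁻¹ = I⁻¹ := by rw [mul_assoc, e1, mul_one]
  refine ⟨!![w 0 * x + v 1 * y', w 0 * y - v 0 * y'; w 1 * x - v 1 * x', w 1 * y + v 0 * x'],
    ⟨?_, ?_, ?_, ?_⟩, ?_, ?_⟩
  · exact FractionalIdeal.add_mem (e1 ▸ mul_mem_mul ha' hx) (e2 ▸ mul_mem_mul hc hy')
  · exact FractionalIdeal.sub_mem (e3 ▸ mul_mem_mul ha' hy) (e3 ▸ mul_mem_mul ha hy')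
  · exact FractionalIdeal.sub_mem (e4 ▸ mul_mem_mul hc' hx) (e4 ▸ mul_mem_mul hc hx')
  · exact FractionalIdeal.add_mem (e2 ▸ mul_mem_mul hc' hy) (e1 ▸ mul_mem_mul ha hx')
  · rw [Matrix.det_fin_two_of]
    linear_combination (w 0 * x' + w 1 * y') * hxy + hxy'
  · ext i
    fin_cases i
    · simp [Matrix.mulVec, dotProduct, Fin.sum_univ_two]
      linear_combination w 0 * hxy
    · simp [Matrix.mulVec, dotProduct, Fin.sum_univ_two]
      linear_combination w 1 * hxy

end FractionalIdeal

/-- The map `(a, c) ↦ a𝔬 + c𝔠*` on nonzero vectors of `F²` is invariant under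
the left action of `G⁺(𝔬⊕𝔠*)` and under scaling by `𝔬^×`, and it induces a
bijection from the double quotient `G⁺(𝔬⊕𝔠*) \ (F² ∖ {0}) / 𝔬^×` onto the set
of all nonzero fractional ideals of `F`. -/
theorem stmt2
    (htotreal : ∀ φ : F →+* ℂ, ComplexEmbedding.IsReal φ)
    (𝔠 : FractionalIdeal (𝓞 F)⁰ F) (h𝔠 : 𝔠 ≠ 0)
    (E : Subgroup (𝓞 F)ˣ)
    (hE : ∀ u ∈ E, ∀ φ : F →+* ℝ, 0 < φ ((u : 𝓞 F) : F)) :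
    -- invariance under the left action of `G⁺(𝔬⊕𝔠*)`
    (∀ γ ∈ GPlus F 𝔠 E, ∀ v : Fin 2 → F, v ≠ 0 →
      cuspIdeal F 𝔠 (γ.mulVec v) = cuspIdeal F 𝔠 v) ∧
    -- invariance under scaling by `𝔬^×`
    (∀ u : (𝓞 F)ˣ, ∀ v : Fin 2 → F, v ≠ 0 →
      cuspIdeal F 𝔠 (((u : 𝓞 F) : F) • v) = cuspIdeal F 𝔠 v) ∧
    -- the map lands in nonzero fractional ideals
    (∀ v : Fin 2 → F, v ≠ 0 → cuspIdeal F 𝔠 v ≠ 0) ∧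
    -- surjectivity onto nonzero fractional ideals
    (∀ J : FractionalIdeal (𝓞 F)⁰ F, J ≠ 0 → ∃ v : Fin 2 → F, v ≠ 0 ∧
      cuspIdeal F 𝔠 v = J) ∧
    -- injectivity on the double quotient: two nonzero vectors have the same
    -- image iff they lie in the same `G⁺(𝔬⊕𝔠*)`-`𝔬^×` double orbit
    (∀ v w : Fin 2 → F, v ≠ 0 → w ≠ 0 →
      (cuspIdeal F 𝔠 v = cuspIdeal F 𝔠 w ↔
        ∃ γ ∈ GPlus F 𝔠 E, ∃ u : (𝓞 F)ˣ,
          w = ((u : 𝓞 F) : F) • γ.mulVec v)) := by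
  have hd : diffF F ≠ 0 := by
    rw [diffF, Ne, coeIdeal_eq_zero]
    exact differentIdeal_ne_bot
  have hI : 𝔠⁻¹ * (diffF F)⁻¹ ≠ 0 := mul_ne_zero (inv_ne_zero h𝔠) (inv_ne_zero hd)
  have hinv : (𝔠⁻¹ * (diffF F)⁻¹)⁻¹ = 𝔠 * diffF F := by rw [mul_inv, inv_inv, inv_inv]
  have hcusp : cuspIdeal F 𝔠 = vecIdeal (𝔠⁻¹ * (diffF F)⁻¹) := rfl
  have hG (γ : Matrix (Fin 2) (Fin 2) F) : γ ∈ GPlus F 𝔠 E ↔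
      γ ∈ order (𝔠⁻¹ * (diffF F)⁻¹) ∧ ∃ u ∈ E, ((u : 𝓞 F) : F) = γ.det := by
    simp only [GPlus, order, Set.mem_ofPred_eq, hinv, and_assoc]
  have hleft : ∀ γ ∈ GPlus F 𝔠 E, ∀ v : Fin 2 → F,
      cuspIdeal F 𝔠 (γ.mulVec v) = cuspIdeal F 𝔠 v := by
    intro γ hγ v
    obtain ⟨hγ, u, -, hu⟩ := (hG γ).1 hγ
    exact vecIdeal_mulVec hI hγ hu v
  refine ⟨fun γ hγ v _ ↦ hleft γ hγ v, fun u v _ ↦ vecIdeal_unit_smul _ u v,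
    fun v hv ↦ vecIdeal_ne_zero hI hv, fun J hJ ↦ exists_vecIdeal_eq hI hJ,
    fun v w hv hw ↦ ⟨fun h ↦ ?_, ?_⟩⟩
  · obtain ⟨g, hg, hdet, hgv⟩ := exists_mem_order_mulVec_eq hI hv hw h
    exact ⟨g, (hG g).2 ⟨hg, 1, one_mem E, by simp [hdet]⟩, 1, by simp [hgv]⟩
  · rintro ⟨γ, hγ, u, rfl⟩
    exact ((vecIdeal_unit_smul _ u _).trans (hleft γ hγ v)).symm
end

section
/- Let a, c ∈ F, not both zero, and set 𝔟 := a𝔬 + c𝔠* and 𝔟' := a𝔬 + c(𝔠𝔫)*. Then 𝔟 and 𝔟' are nonzero fractional ideals satisfying 𝔟 ⊆ 𝔟' ⊆ 𝔫⁻¹𝔟, and one has 𝔟' = 𝔟 if and only if c ∈ 𝔫𝔟𝔠𝔡. -/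
open NumberField FractionalIdeal
open scoped nonZeroDivisors

variable (F : Type*) [Field F] [NumberField F]

/-- The fractional ideal `𝔟 = a𝔬 + c𝔠*`, where `𝔠* = 𝔠⁻¹𝔡⁻¹`. -/
noncomputable def idealB (𝔠 : FractionalIdeal (𝓞 F)⁰ F) (a c : F) :
    FractionalIdeal (𝓞 F)⁰ F :=
  spanSingleton (𝓞 F)⁰ a + spanSingleton (𝓞 F)⁰ c * (𝔠⁻¹ * (diffF F)⁻¹)

/-- The fractional ideal `𝔟' = a𝔬 + c(𝔠𝔫)*`, where `(𝔠𝔫)* = (𝔠𝔫)⁻¹𝔡⁻¹`. -/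
noncomputable def idealB' (𝔠 : FractionalIdeal (𝓞 F)⁰ F) (𝔫 : Ideal (𝓞 F)) (a c : F) :
    FractionalIdeal (𝓞 F)⁰ F :=
  spanSingleton (𝓞 F)⁰ a +
    spanSingleton (𝓞 F)⁰ c * ((𝔠 * (𝔫 : FractionalIdeal (𝓞 F)⁰ F))⁻¹ * (diffF F)⁻¹)

section DedekindDomain

variable {A K : Type*} [CommRing A] [IsDedekindDomain A] [Field K] [Algebra A K]
  [IsFractionRing A K]

theorem FractionalIdeal.one_le_inv_coeIdeal {I : Ideal A} (hI : I ≠ 0) :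
    1 ≤ (I : FractionalIdeal A⁰ K)⁻¹ :=
  (one_le_inv₀ (pos_iff_ne_zero.mpr (coeIdeal_ne_zero.mpr hI))).mpr coeIdeal_le_one

theorem FractionalIdeal.spanSingleton_add_spanSingleton_mul_ne_zero {x y : K}
    (hxy : ¬(x = 0 ∧ y = 0)) {J : FractionalIdeal A⁰ K} (hJ : J ≠ 0) :
    spanSingleton A⁰ x + spanSingleton A⁰ y * J ≠ 0 := by
  rw [Ne, add_eq_zero, mul_eq_zero, spanSingleton_eq_zero_iff, spanSingleton_eq_zero_iff,
    or_iff_left hJ]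
  exact hxy

theorem FractionalIdeal.add_inv_mul_eq_add_iff {N : FractionalIdeal A⁰ K} (hN : N ≠ 0)
    (hN1 : 1 ≤ N⁻¹) (S T : FractionalIdeal A⁰ K) :
    S + N⁻¹ * T = S + T ↔ T ≤ N * (S + T) := by
  have hT : T ≤ N⁻¹ * T := le_mul_of_one_le_left' hN1
  rw [← inv_mul_le_iff₀ (pos_iff_ne_zero.mpr hN)]
  refine ⟨fun h => h ▸ le_add_self, fun h => le_antisymm ?_ (by gcongr)⟩
  rw [← sup_eq_add S (N⁻¹ * T)]
  exact sup_le le_self_add h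

end DedekindDomain

theorem diffF_ne_zero : diffF F ≠ 0 :=
  coeIdeal_ne_zero.mpr differentIdeal_ne_bot

theorem idealB'_eq (𝔠 : FractionalIdeal (𝓞 F)⁰ F) (𝔫 : Ideal (𝓞 F)) (a c : F) :
    idealB' F 𝔠 𝔫 a c = spanSingleton (𝓞 F)⁰ a + (𝔫 : FractionalIdeal (𝓞 F)⁰ F)⁻¹ *
      (spanSingleton (𝓞 F)⁰ c * (𝔠⁻¹ * (diffF F)⁻¹)) := by
  rw [idealB', mul_inv]
  ring

/-- For `(a, c) ≠ (0, 0)`, the fractional ideals `𝔟 = a𝔬 + c𝔠*` and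
`𝔟' = a𝔬 + c(𝔠𝔫)*` are nonzero and satisfy `𝔟 ⊆ 𝔟' ⊆ 𝔫⁻¹𝔟`; moreover `𝔟' = 𝔟`
if and only if `c ∈ 𝔫𝔟𝔠𝔡` (i.e. the `(R,𝔫)`-cusp is unramified). -/
theorem stmt4
    (htotreal : ∀ φ : F →+* ℂ, ComplexEmbedding.IsReal φ)
    (𝔠 : FractionalIdeal (𝓞 F)⁰ F) (h𝔠 : 𝔠 ≠ 0)
    (𝔫 : Ideal (𝓞 F)) (h𝔫 : 𝔫 ≠ 0)
    (a c : F) (hac : ¬(a = 0 ∧ c = 0)) :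
    idealB F 𝔠 a c ≠ 0 ∧
    idealB' F 𝔠 𝔫 a c ≠ 0 ∧
    idealB F 𝔠 a c ≤ idealB' F 𝔠 𝔫 a c ∧
    idealB' F 𝔠 𝔫 a c ≤ (𝔫 : FractionalIdeal (𝓞 F)⁰ F)⁻¹ * idealB F 𝔠 a c ∧
    (idealB' F 𝔠 𝔫 a c = idealB F 𝔠 a c ↔
      c ∈ (𝔫 : FractionalIdeal (𝓞 F)⁰ F) * idealB F 𝔠 a c * 𝔠 * diffF F) := by
  have h𝔡 := diffF_ne_zero F
  have hN : (𝔫 : FractionalIdeal (𝓞 F)⁰ F) ≠ 0 := coeIdeal_ne_zero.mpr h𝔫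
  have hN1 : 1 ≤ (𝔫 : FractionalIdeal (𝓞 F)⁰ F)⁻¹ := one_le_inv_coeIdeal h𝔫
  refine ⟨spanSingleton_add_spanSingleton_mul_ne_zero hac
      (mul_ne_zero (inv_ne_zero h𝔠) (inv_ne_zero h𝔡)),
    spanSingleton_add_spanSingleton_mul_ne_zero hac
      (mul_ne_zero (inv_ne_zero (mul_ne_zero h𝔠 hN)) (inv_ne_zero h𝔡)), ?_, ?_, ?_⟩
  · rw [idealB'_eq, idealB]
    exact add_le_add le_rfl (le_mul_of_one_le_left' hN1)
  · rw [idealB'_eq, idealB, mul_add]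
    gcongr
    exact le_mul_of_one_le_left' hN1
  · rw [idealB'_eq, idealB, add_inv_mul_eq_add_iff hN hN1, ← spanSingleton_le_iff_mem,
      ← mul_assoc (spanSingleton _ c), mul_inv_le_iff₀ (pos_iff_ne_zero.mpr h𝔡),
      mul_inv_le_iff₀ (pos_iff_ne_zero.mpr h𝔠), mul_right_comm _ (diffF F)]
end

section
/- Let 𝔟 be a nonzero fractional ideal and γ = (a b; c d) ∈ GL₂(F) with a ∈ 𝔟, b ∈ (𝔟𝔠)*, c ∈ 𝔟𝔠𝔡, d ∈ 𝔟⁻¹, det γ ∈ E, and 𝔟 = a𝔬 + c𝔠*; set 𝔟' := a𝔬 + c(𝔠𝔫)*. Then the set { ξ ∈ F : γ · (1 ξ; 0 1) · γ⁻¹ ∈ Γ } is exactly the fractional ideal (𝔠𝔟𝔟')* = (𝔠𝔟𝔟')⁻¹𝔡⁻¹. In other words, the unipotent part of γ⁻¹Γγ ∩ B (B the group of upper triangular matrices) is the additive group X* where X = 𝔠𝔟𝔟'. -/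
open NumberField FractionalIdeal
open scoped nonZeroDivisors

variable (F : Type*) [Field F] [NumberField F]

/-- The congruence group `Γ = Γ₁^D(𝔠,𝔫)`: matrices `(a b; c d) ∈ GL₂(F)` with
`a ∈ 𝔬`, `b ∈ 𝔠* = 𝔠⁻¹𝔡⁻¹`, `c ∈ 𝔫𝔠𝔡`, `d ∈ 𝔬`, `d − 1 ∈ 𝔫` and determinant
in `E`. -/
noncomputable def GammaD (𝔠 : FractionalIdeal (𝓞 F)⁰ F) (𝔫 : Ideal (𝓞 F))
    (E : Subgroup (𝓞 F)ˣ) : Set (Matrix (Fin 2) (Fin 2) F) :=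
  {γ | γ 0 0 ∈ (1 : FractionalIdeal (𝓞 F)⁰ F) ∧
       γ 0 1 ∈ 𝔠⁻¹ * (diffF F)⁻¹ ∧
       γ 1 0 ∈ (𝔫 : FractionalIdeal (𝓞 F)⁰ F) * 𝔠 * diffF F ∧
       γ 1 1 ∈ (1 : FractionalIdeal (𝓞 F)⁰ F) ∧
       γ 1 1 - 1 ∈ (𝔫 : FractionalIdeal (𝓞 F)⁰ F) ∧
       ∃ u ∈ E, ((u : 𝓞 F) : F) = γ.det}

theorem FractionalIdeal.spanSingleton_mul_le_iff_mem {R K : Type*} [CommRing R]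
    [IsDedekindDomain R] [Field K] [Algebra R K] [IsFractionRing R K] {x : K}
    {I J : FractionalIdeal R⁰ K} (hI : I ≠ 0) :
    spanSingleton R⁰ x * I ≤ J ↔ x ∈ J * I⁻¹ := by
  rw [← spanSingleton_le_iff_mem, le_mul_inv_iff₀ (pos_iff_ne_zero.mpr hI)]

/-- Dividing by a unit of `𝓞 F` does not affect membership in a fractional ideal. -/
theorem FractionalIdeal.div_unit_mem_iff {F : Type*} [Field F] [NumberField F]
    (I : FractionalIdeal (𝓞 F)⁰ F) (u : (𝓞 F)ˣ) (x : F) :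
    x / ((u : 𝓞 F) : F) ∈ I ↔ x ∈ I := by
  have hu : ((u : 𝓞 F) : F) ≠ 0 := by simp
  have key : ∀ (v : 𝓞 F) {y : F}, y ∈ I → (v : F) * y ∈ I := fun v y hy => by
    simpa [Algebra.smul_def] using (I : Submodule (𝓞 F) F).smul_mem v hy
  constructor
  · intro h
    simpa [mul_div_cancel₀ _ hu] using key u h
  · intro h
    have := key (u⁻¹ : (𝓞 F)ˣ) h
    rwa [show (((u⁻¹ : (𝓞 F)ˣ) : 𝓞 F) : F) = (((u : 𝓞 F) : F))⁻¹ from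
      eq_inv_of_mul_eq_one_left (by rw [← map_mul]; simp), mul_comm, ← div_eq_mul_inv] at this

/-- The dual of a product of two ideals, each generated by `a` and a multiple of `c`. -/
theorem FractionalIdeal.mem_inv_mul_add_mul_add_iff {R K : Type*} [CommRing R]
    [IsDedekindDomain R] [Field K] [Algebra R K] [IsFractionRing R K]
    {I N : FractionalIdeal R⁰ K} (hI : I ≠ 0) (hN : N ≠ 0) (hN1 : N ≤ 1) {a c ξ : K}
    (hX : (spanSingleton R⁰ a + spanSingleton R⁰ c * I⁻¹) *
      (spanSingleton R⁰ a + spanSingleton R⁰ c * (I * N)⁻¹) ≠ 0) :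
    ξ ∈ (I * ((spanSingleton R⁰ a + spanSingleton R⁰ c * I⁻¹) *
        (spanSingleton R⁰ a + spanSingleton R⁰ c * (I * N)⁻¹)))⁻¹ ↔
      a ^ 2 * ξ ∈ I⁻¹ ∧ a * c * ξ ∈ N ∧ c ^ 2 * ξ ∈ N * I := by
  have expand : spanSingleton R⁰ ξ * (I * ((spanSingleton R⁰ a + spanSingleton R⁰ c * I⁻¹) *
        (spanSingleton R⁰ a + spanSingleton R⁰ c * (I * N)⁻¹))) =
      spanSingleton R⁰ (a ^ 2 * ξ) * I + spanSingleton R⁰ (a * c * ξ) * N⁻¹ +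
        spanSingleton R⁰ (a * c * ξ) * 1 + spanSingleton R⁰ (c ^ 2 * ξ) * (N * I)⁻¹ := by
    simp only [pow_two, ← spanSingleton_mul_spanSingleton]
    field_simp
    ring
  rw [← one_mul (_ : FractionalIdeal R⁰ K)⁻¹,
    ← spanSingleton_mul_le_iff_mem (mul_ne_zero hI hX), expand]
  simp only [← sup_eq_add, sup_le_iff]
  rw [spanSingleton_mul_le_iff_mem hI, spanSingleton_mul_le_iff_mem (inv_ne_zero hN),
    mul_one, spanSingleton_le_iff_mem,
    spanSingleton_mul_le_iff_mem (inv_ne_zero (mul_ne_zero hN hI))]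
  simp only [one_mul, inv_inv]
  exact ⟨fun ⟨⟨⟨h₁, h₂⟩, _⟩, h₄⟩ => ⟨h₁, h₂, h₄⟩, fun ⟨h₁, h₂, h₄⟩ => ⟨⟨⟨h₁, h₂⟩, hN1 h₂⟩, h₄⟩⟩

/-- Conjugating an elementary unipotent matrix. -/
theorem Matrix.conj_unipotent_fin_two {K : Type*} [Field K] {a b c d : K}
    (h : (!![a, b; c, d] : Matrix (Fin 2) (Fin 2) K).det ≠ 0) (ξ : K) :
    !![a, b; c, d] * !![1, ξ; 0, 1] * (!![a, b; c, d])⁻¹ =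
      !![1 - a * c * ξ / (!![a, b; c, d] : Matrix (Fin 2) (Fin 2) K).det,
        a ^ 2 * ξ / (!![a, b; c, d] : Matrix (Fin 2) (Fin 2) K).det;
        -(c ^ 2 * ξ / (!![a, b; c, d] : Matrix (Fin 2) (Fin 2) K).det),
        1 + a * c * ξ / (!![a, b; c, d] : Matrix (Fin 2) (Fin 2) K).det] := by
  have hdet := (Matrix.det_fin_two_of a b c d).symm
  rw [Matrix.inv_def, Matrix.adjugate_fin_two_of, Ring.inverse_eq_inv']
  generalize (!![a, b; c, d] : Matrix (Fin 2) (Fin 2) K).det = Δ at h hdet ⊢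
  ext i j
  fin_cases i <;> fin_cases j <;> simp [Matrix.mul_apply, Fin.sum_univ_two] <;>
    field_simp <;> first | ring1 | linear_combination hdet

/-- Proposition `deuxideaux (iv)`, unipotent part: with `𝔟 = a𝔬 + c𝔠*` and
`𝔟' = a𝔬 + c(𝔠𝔫)*`, the set of `ξ ∈ F` with `γ (1 ξ; 0 1) γ⁻¹ ∈ Γ` is exactly
the fractional ideal `X* = (𝔠𝔟𝔟')* = (𝔠𝔟𝔟')⁻¹𝔡⁻¹`. -/
theorem stmt5
    (htotreal : ∀ φ : F →+* ℂ, ComplexEmbedding.IsReal φ)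
    (𝔠 : FractionalIdeal (𝓞 F)⁰ F) (h𝔠 : 𝔠 ≠ 0)
    (𝔫 : Ideal (𝓞 F)) (h𝔫 : 𝔫 ≠ 0)
    (E : Subgroup (𝓞 F)ˣ)
    (hE : ∀ u ∈ E, ∀ φ : F →+* ℝ, 0 < φ ((u : 𝓞 F) : F))
    (𝔟 : FractionalIdeal (𝓞 F)⁰ F) (h𝔟 : 𝔟 ≠ 0)
    (a b c d : F)
    (ha : a ∈ 𝔟) (hb : b ∈ (𝔟 * 𝔠)⁻¹ * (diffF F)⁻¹)
    (hc : c ∈ 𝔟 * 𝔠 * diffF F) (hd : d ∈ 𝔟⁻¹)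
    (hdet : ∃ u ∈ E, ((u : 𝓞 F) : F) = (!![a, b; c, d] : Matrix (Fin 2) (Fin 2) F).det)
    (h𝔟eq : 𝔟 = spanSingleton (𝓞 F)⁰ a +
      spanSingleton (𝓞 F)⁰ c * (𝔠⁻¹ * (diffF F)⁻¹))
    (𝔟' : FractionalIdeal (𝓞 F)⁰ F)
    (h𝔟' : 𝔟' = spanSingleton (𝓞 F)⁰ a +
      spanSingleton (𝓞 F)⁰ c * ((𝔠 * (𝔫 : FractionalIdeal (𝓞 F)⁰ F))⁻¹ * (diffF F)⁻¹)) :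
    ∀ ξ : F,
      (!![a, b; c, d] * !![1, ξ; 0, 1] * (!![a, b; c, d])⁻¹ ∈ GammaD F 𝔠 𝔫 E) ↔
        ξ ∈ (𝔠 * 𝔟 * 𝔟')⁻¹ * (diffF F)⁻¹ := by
  intro ξ
  obtain ⟨u, -, hu⟩ := hdet
  have hI : 𝔠 * diffF F ≠ 0 := mul_ne_zero h𝔠 (diffF_ne_zero F)
  have hN : (𝔫 : FractionalIdeal (𝓞 F)⁰ F) ≠ 0 := coeIdeal_ne_zero.mpr h𝔫
  have hN1 : (𝔫 : FractionalIdeal (𝓞 F)⁰ F) ≤ 1 := coeIdeal_le_one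
  have hdet0 : (!![a, b; c, d] : Matrix (Fin 2) (Fin 2) F).det ≠ 0 := by rw [← hu]; simp
  have h𝔟eq' : 𝔟 = spanSingleton (𝓞 F)⁰ a +
      spanSingleton (𝓞 F)⁰ c * (𝔠 * diffF F)⁻¹ := by rw [mul_inv]; exact h𝔟eq
  have h𝔟'eq : 𝔟' = spanSingleton (𝓞 F)⁰ a + spanSingleton (𝓞 F)⁰ c *
      (𝔠 * diffF F * (𝔫 : FractionalIdeal (𝓞 F)⁰ F))⁻¹ := by
    rw [h𝔟', ← mul_inv, mul_right_comm]
  have h𝔟'0 : 𝔟' ≠ 0 := by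
    intro h0
    rw [h𝔟'eq, ← sup_eq_add, ← FractionalIdeal.bot_eq_zero, sup_eq_bot_iff,
      FractionalIdeal.bot_eq_zero, mul_eq_zero_iff_right (inv_ne_zero (mul_ne_zero hI hN))] at h0
    apply h𝔟
    rw [h𝔟eq, h0.1, h0.2, zero_mul, add_zero]
  have target : (𝔠 * 𝔟 * 𝔟')⁻¹ * (diffF F)⁻¹ = (𝔠 * diffF F * (𝔟 * 𝔟'))⁻¹ := by
    rw [← mul_inv]
    congr 1
    ring
  have h𝔟𝔟' := mul_ne_zero h𝔟 h𝔟'0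
  rw [target, h𝔟eq', h𝔟'eq]
  rw [h𝔟eq', h𝔟'eq] at h𝔟𝔟'
  rw [mem_inv_mul_add_mul_add_iff hI hN hN1 h𝔟𝔟', Matrix.conj_unipotent_fin_two hdet0, ← hu,
    ← div_unit_mem_iff _ u (a ^ 2 * ξ), ← div_unit_mem_iff _ u (a * c * ξ),
    ← div_unit_mem_iff _ u (c ^ 2 * ξ)]
  set p := a ^ 2 * ξ / ((u : 𝓞 F) : F) with hp
  set q := a * c * ξ / ((u : 𝓞 F) : F) with hq
  set r := c ^ 2 * ξ / ((u : 𝓞 F) : F) with hr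
  have hpr : q * q = p * r := by
    rw [hp, hq, hr]
    ring
  have h1 : (1 : F) ∈ (1 : FractionalIdeal (𝓞 F)⁰ F) := one_mem_one _
  have neg_r : -r ∈ (𝔫 : FractionalIdeal (𝓞 F)⁰ F) * 𝔠 * diffF F ↔
      r ∈ (𝔫 : FractionalIdeal (𝓞 F)⁰ F) * (𝔠 * diffF F) := by
    rw [mul_assoc]
    exact neg_mem_iff (H := ((_ : FractionalIdeal (𝓞 F)⁰ F) : Submodule (𝓞 F) F))
  simp only [GammaD, Set.mem_ofPred_eq, Matrix.of_apply, Matrix.cons_val', Matrix.cons_val_zero,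
    Matrix.cons_val_one, Matrix.cons_val_fin_one, add_sub_cancel_left, neg_r, mul_inv]
  constructor
  · rintro ⟨-, h₂, h₃, -, h₅, -⟩
    exact ⟨h₂, h₅, h₃⟩
  · rintro ⟨h₂, h₅, h₃⟩
    refine ⟨Submodule.sub_mem _ h1 (hN1 h₅), h₂, h₃, Submodule.add_mem _ h1 (hN1 h₅), h₅,
      1, E.one_mem, ?_⟩
    rw [Matrix.det_fin_two_of]
    simp only [Units.val_one, map_one]
    linear_combination hpr
end

section
/- Let a ∈ F and c ∈ F^× (c ≠ 0), and set 𝔟 := a𝔬 + c𝔠* and 𝔟' := a𝔬 + c(𝔠𝔫)*. Then c⁻¹(𝔫𝔟𝔠𝔡) ∩ 𝔬 = 𝔟𝔟'⁻¹, an equality of fractional ideals of F (where c⁻¹𝔣 denotes the product of the fractional module generated by c⁻¹ with 𝔣, and the intersection is taken inside F). -/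
open NumberField FractionalIdeal
open scoped nonZeroDivisors

variable (F : Type*) [Field F] [NumberField F]

/-- For `b = A + C` and `C ≤ C'` with `C ≠ 0`, one has `b / C' ∩ 1 = b / (A + C')`. -/
theorem FractionalIdeal.add_div_inf_one {R K : Type*} [CommRing R] [IsDedekindDomain R] [Field K]
    [Algebra R K] [IsFractionRing R K] {A C C' : FractionalIdeal R⁰ K} (hC : C ≠ 0)
    (hCC' : C ≤ C') : (A + C) / C' ⊓ 1 = (A + C) / (A + C') := by
  have ne_zero_of_le {I J : FractionalIdeal R⁰ K} (h : I ≤ J) (hI : I ≠ 0) : J ≠ 0 := by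
    rintro rfl
    exact hI (le_zero_iff.mp h)
  have hC' : C' ≠ 0 := ne_zero_of_le hCC' hC
  have hb : A + C ≠ 0 := ne_zero_of_le (by simp only [← sup_eq_add, le_sup_right]) hC
  have hb' : A + C' ≠ 0 := ne_zero_of_le (by simp only [← sup_eq_add, le_sup_right]) hC'
  refine eq_of_forall_le_iff fun X => ?_
  have hone : X ≤ 1 ↔ X * (A + C) ≤ A + C := by
    rw [← le_div_iff_mul_le hb, div_self hb]
  rw [le_inf_iff, hone, le_div_iff_mul_le hC', le_div_iff_mul_le hb', mul_add, mul_add]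
  simp only [← sup_eq_add, sup_le_iff]
  exact ⟨fun h => ⟨h.2.1, h.1⟩, fun h => ⟨h.2, h.1, (mul_right_mono hCC').trans h.2⟩⟩

/-- With `𝔟 = a𝔬 + c𝔠*` and `𝔟' = a𝔬 + c(𝔠𝔫)*` (`c ≠ 0`), one has the equality
of fractional ideals `c⁻¹(𝔫𝔟𝔠𝔡) ∩ 𝔬 = 𝔟𝔟'⁻¹`. -/
theorem stmt8
    (htotreal : ∀ φ : F →+* ℂ, ComplexEmbedding.IsReal φ)
    (𝔠 : FractionalIdeal (𝓞 F)⁰ F) (h𝔠 : 𝔠 ≠ 0)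
    (𝔫 : Ideal (𝓞 F)) (h𝔫 : 𝔫 ≠ 0)
    (a c : F) (hc : c ≠ 0) :
    spanSingleton (𝓞 F)⁰ c⁻¹ *
        ((𝔫 : FractionalIdeal (𝓞 F)⁰ F) * idealB F 𝔠 a c * 𝔠 * diffF F) ⊓
        (1 : FractionalIdeal (𝓞 F)⁰ F) =
      idealB F 𝔠 a c * (idealB' F 𝔠 𝔫 a c)⁻¹ := by
  have hd : diffF F ≠ 0 := coeIdeal_ne_zero.mpr differentIdeal_ne_bot
  have hn : (𝔫 : FractionalIdeal (𝓞 F)⁰ F) ≠ 0 := coeIdeal_ne_zero.mpr h𝔫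
  have hs : spanSingleton (𝓞 F)⁰ c ≠ 0 := spanSingleton_ne_zero_iff.mpr hc
  have hC : spanSingleton (𝓞 F)⁰ c * (𝔠⁻¹ * (diffF F)⁻¹) ≠ 0 :=
    mul_ne_zero hs (mul_ne_zero (inv_ne_zero h𝔠) (inv_ne_zero hd))
  have hle : spanSingleton (𝓞 F)⁰ c * (𝔠⁻¹ * (diffF F)⁻¹) ≤
      spanSingleton (𝓞 F)⁰ c *
        ((𝔠 * (𝔫 : FractionalIdeal (𝓞 F)⁰ F))⁻¹ * (diffF F)⁻¹) := by
    have heq : spanSingleton (𝓞 F)⁰ c *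
        ((𝔠 * (𝔫 : FractionalIdeal (𝓞 F)⁰ F))⁻¹ * (diffF F)⁻¹) =
        spanSingleton (𝓞 F)⁰ c * (𝔠⁻¹ * (diffF F)⁻¹) / 𝔫 := by
      field_simp
    rw [heq, le_div_iff_mul_le hn]
    exact mul_le_of_le_one_right' coeIdeal_le_one
  rw [← div_eq_mul_inv, idealB', idealB, ← add_div_inf_one hC hle, ← spanSingleton_inv]
  congr 1
  field_simp
end

section
/- Let a ∈ F and c ∈ F^× (c ≠ 0), and set 𝔟 := a𝔬 + c𝔠* and 𝔟' := a𝔬 + c(𝔠𝔫)*. Then c⁻¹(𝔫𝔟⁻¹) ∩ (𝔠𝔟²)* = (𝔠𝔟𝔟')*, an equality of fractional ideals of F. Equivalently, for ξ ∈ F one has ξ ∈ (𝔠𝔟²)* and ξc ∈ 𝔫𝔟⁻¹ if and only if ξ ∈ (𝔠𝔟𝔟')*. -/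
open NumberField FractionalIdeal
open scoped nonZeroDivisors

variable (F : Type*) [Field F] [NumberField F]

/-- In the group of nonzero fractional ideals, inversion turns sums into intersections. -/
theorem FractionalIdeal.inv_add_eq_inv_inf_inv {R K : Type*} [CommRing R] [IsDedekindDomain R]
    [Field K] [Algebra R K] [IsFractionRing R K] {I J : FractionalIdeal R⁰ K}
    (hI : I ≠ 0) (hJ : J ≠ 0) : (I + J)⁻¹ = I⁻¹ ⊓ J⁻¹ := by
  have hIJ : I + J ≠ 0 := fun h =>
    hI (le_antisymm (by rw [← h, ← sup_eq_add]; exact le_sup_left) (FractionalIdeal.zero_le I))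
  have le_inv_iff {X Y : FractionalIdeal R⁰ K} (hY : Y ≠ 0) : X ≤ Y⁻¹ ↔ X * Y ≤ 1 := by
    rw [inv_eq, FractionalIdeal.le_div_iff_mul_le hY]
  refine eq_of_forall_le_iff fun X => ?_
  rw [le_inf_iff, le_inv_iff hI, le_inv_iff hJ, le_inv_iff hIJ, mul_add, ← sup_eq_add,
    sup_le_iff]

/-- With `𝔟 = a𝔬 + c𝔠*` and `𝔟' = a𝔬 + c(𝔠𝔫)*` (`c ≠ 0`), one has the equality
of fractional ideals `c⁻¹(𝔫𝔟⁻¹) ∩ (𝔠𝔟²)* = (𝔠𝔟𝔟')*`; equivalently, an element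
`ξ ∈ F` satisfies `ξ ∈ (𝔠𝔟²)*` and `ξc ∈ 𝔫𝔟⁻¹` if and only if `ξ ∈ (𝔠𝔟𝔟')*`. -/
theorem stmt9
    (htotreal : ∀ φ : F →+* ℂ, ComplexEmbedding.IsReal φ)
    (𝔠 : FractionalIdeal (𝓞 F)⁰ F) (h𝔠 : 𝔠 ≠ 0)
    (𝔫 : Ideal (𝓞 F)) (h𝔫 : 𝔫 ≠ 0)
    (a c : F) (hc : c ≠ 0) :
    spanSingleton (𝓞 F)⁰ c⁻¹ *
        ((𝔫 : FractionalIdeal (𝓞 F)⁰ F) * (idealB F 𝔠 a c)⁻¹) ⊓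
        (𝔠 * idealB F 𝔠 a c ^ 2)⁻¹ * (diffF F)⁻¹ =
      (𝔠 * idealB F 𝔠 a c * idealB' F 𝔠 𝔫 a c)⁻¹ * (diffF F)⁻¹ := by
  have h𝔫' : (𝔫 : FractionalIdeal (𝓞 F)⁰ F) ≠ 0 := coeIdeal_ne_zero.mpr h𝔫
  have h𝔡 : diffF F ≠ 0 := coeIdeal_ne_zero.mpr differentIdeal_ne_bot
  have hcs : spanSingleton (𝓞 F)⁰ c ≠ 0 := spanSingleton_ne_zero_iff.mpr hc
  have h𝔟 : idealB F 𝔠 a c ≠ 0 := fun h =>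
    mul_ne_zero hcs (mul_ne_zero (inv_ne_zero h𝔠) (inv_ne_zero h𝔡))
      (le_antisymm (by rw [← h, idealB, ← sup_eq_add]; exact le_sup_right)
        (FractionalIdeal.zero_le _))
  have h𝔟' : idealB' F 𝔠 𝔫 a c = idealB F 𝔠 a c +
      spanSingleton (𝓞 F)⁰ c *
        ((𝔠 * (𝔫 : FractionalIdeal (𝓞 F)⁰ F))⁻¹ * (diffF F)⁻¹) := by
    have hle : spanSingleton (𝓞 F)⁰ c * (𝔠⁻¹ * (diffF F)⁻¹) ≤ spanSingleton (𝓞 F)⁰ c *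
        ((𝔠 * (𝔫 : FractionalIdeal (𝓞 F)⁰ F))⁻¹ * (diffF F)⁻¹) := by
      have h := mul_le_mul_left (coeIdeal_le_one (S := (𝓞 F)⁰) (P := F) (I := 𝔫)) (spanSingleton (𝓞 F)⁰ c *
        ((𝔠 * (𝔫 : FractionalIdeal (𝓞 F)⁰ F))⁻¹ * (diffF F)⁻¹))
      convert h using 1 <;> field_simp
    rw [idealB', idealB, add_assoc, ← sup_eq_add (spanSingleton _ c * _), sup_eq_right.mpr hle]
  have hinv : (𝔠 * idealB F 𝔠 a c * idealB' F 𝔠 𝔫 a c)⁻¹ * (diffF F)⁻¹ =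
      (spanSingleton (𝓞 F)⁰ c * (idealB F 𝔠 a c * (𝔫 : FractionalIdeal (𝓞 F)⁰ F)⁻¹) +
        𝔠 * idealB F 𝔠 a c ^ 2 * diffF F)⁻¹ := by
    rw [← mul_inv, h𝔟']
    congr 1
    field_simp
    ring
  rw [hinv, FractionalIdeal.inv_add_eq_inv_inf_inv
    (mul_ne_zero hcs (mul_ne_zero h𝔟 (inv_ne_zero h𝔫')))
    (mul_ne_zero (mul_ne_zero h𝔠 (pow_ne_zero 2 h𝔟)) h𝔡)]
  simp only [mul_inv, inv_inv, spanSingleton_inv, mul_comm (idealB F 𝔠 a c)⁻¹]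
end

section
/- Let 𝔟 be a nonzero fractional ideal of F and let a, b, c, d ∈ F satisfy a ∈ 𝔟, b ∈ (𝔟𝔠)*, c ∈ 𝔟𝔠𝔡, d ∈ 𝔟⁻¹, and ad − bc ∈ 𝔬^×. Then d𝔟 + c(𝔟𝔠)* = 𝔬, an equality of fractional ideals of F. -/
open NumberField FractionalIdeal
open scoped nonZeroDivisors

variable (F : Type*) [Field F] [NumberField F]

/-- If `d ∈ I⁻¹` then `d I` is integral. -/
theorem spanSingleton_mul_le_one_of_mem_inv {R K : Type*} [CommRing R] [IsDedekindDomain R]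
    [Field K] [Algebra R K] [IsFractionRing R K] {I : FractionalIdeal R⁰ K} {d : K}
    (hd : d ∈ I⁻¹) : spanSingleton R⁰ d * I ≤ 1 :=
  calc spanSingleton R⁰ d * I ≤ I⁻¹ * I := mul_le_mul_left (spanSingleton_le_iff_mem.mpr hd) I
    _ ≤ 1 := inv_mul_le_one

/-- A fractional ideal containing a unit of the base ring contains the unit ideal. -/
theorem one_le_of_algebraMap_unit_mem {R K : Type*} [CommRing R] [Field K] [Algebra R K]
    {I : FractionalIdeal R⁰ K} (u : Rˣ) (hu : algebraMap R K u ∈ I) : 1 ≤ I := by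
  rw [FractionalIdeal.one_le]
  have h := I.val.smul_mem (↑u⁻¹ : R) hu
  rwa [Algebra.smul_def, ← map_mul, Units.inv_mul, map_one] at h

/-- Unimodularity: if the matrix `(a b; c d)` satisfies `a ∈ 𝔟`, `b ∈ (𝔟𝔠)*`,
`c ∈ 𝔟𝔠𝔡`, `d ∈ 𝔟⁻¹` and `ad − bc ∈ 𝔬^×`, then `d𝔟 + c(𝔟𝔠)* = 𝔬` as
fractional ideals. -/
theorem stmt10
    (htotreal : ∀ φ : F →+* ℂ, ComplexEmbedding.IsReal φ)
    (𝔠 : FractionalIdeal (𝓞 F)⁰ F) (h𝔠 : 𝔠 ≠ 0)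
    (𝔟 : FractionalIdeal (𝓞 F)⁰ F) (h𝔟 : 𝔟 ≠ 0)
    (a b c d : F)
    (ha : a ∈ 𝔟) (hb : b ∈ (𝔟 * 𝔠)⁻¹ * (diffF F)⁻¹)
    (hc : c ∈ 𝔟 * 𝔠 * diffF F) (hd : d ∈ 𝔟⁻¹)
    (hdet : ∃ u : (𝓞 F)ˣ, ((u : 𝓞 F) : F) = a * d - b * c) :
    spanSingleton (𝓞 F)⁰ d * 𝔟 +
        spanSingleton (𝓞 F)⁰ c * ((𝔟 * 𝔠)⁻¹ * (diffF F)⁻¹) =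
      (1 : FractionalIdeal (𝓞 F)⁰ F) := by
  obtain ⟨u, hu⟩ := hdet
  apply le_antisymm
  · rw [← sup_eq_add]
    refine sup_le (spanSingleton_mul_le_one_of_mem_inv hd)
      (spanSingleton_mul_le_one_of_mem_inv ?_)
    rwa [← mul_inv, inv_inv]
  · refine one_le_of_algebraMap_unit_mem u ?_
    rw [show algebraMap (𝓞 F) F u = _ from hu, ← sup_eq_add, mul_comm a d, mul_comm b c]
    exact Submodule.sub_mem _
      (Submodule.mem_sup_left (mul_mem_mul (mem_spanSingleton_self _ d) ha))
      (Submodule.mem_sup_right (mul_mem_mul (mem_spanSingleton_self _ c) hb))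
end

section
/- Let a, c ∈ F, not both zero, and set 𝔟 := a𝔬 + c𝔠* and 𝔟' := a𝔬 + c(𝔠𝔫)*. Then 𝔫𝔟⁻¹ + c(𝔠𝔟²)* = 𝔫𝔟'𝔟⁻², an equality of fractional ideals of F. -/
open NumberField FractionalIdeal
open scoped nonZeroDivisors

variable (F : Type*) [Field F] [NumberField F]

/-- With `𝔟 = a𝔬 + c𝔠*` and `𝔟' = a𝔬 + c(𝔠𝔫)*` (`(a,c) ≠ (0,0)`), one has the
equality of fractional ideals `𝔫𝔟⁻¹ + c(𝔠𝔟²)* = 𝔫𝔟'𝔟⁻²`. -/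
theorem stmt11
    (htotreal : ∀ φ : F →+* ℂ, ComplexEmbedding.IsReal φ)
    (𝔠 : FractionalIdeal (𝓞 F)⁰ F) (h𝔠 : 𝔠 ≠ 0)
    (𝔫 : Ideal (𝓞 F)) (h𝔫 : 𝔫 ≠ 0)
    (a c : F) (hac : ¬(a = 0 ∧ c = 0)) :
    (𝔫 : FractionalIdeal (𝓞 F)⁰ F) * (idealB F 𝔠 a c)⁻¹ +
        spanSingleton (𝓞 F)⁰ c * ((𝔠 * idealB F 𝔠 a c ^ 2)⁻¹ * (diffF F)⁻¹) =
      (𝔫 : FractionalIdeal (𝓞 F)⁰ F) * idealB' F 𝔠 𝔫 a c * (idealB F 𝔠 a c)⁻¹ ^ 2 := by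
  have hn : (𝔫 : FractionalIdeal (𝓞 F)⁰ F) ≠ 0 := coeIdeal_ne_zero.mpr h𝔫
  have hB' : (𝔫 : FractionalIdeal (𝓞 F)⁰ F) * idealB' F 𝔠 𝔫 a c =
      𝔫 * spanSingleton (𝓞 F)⁰ a + spanSingleton (𝓞 F)⁰ c * (𝔠⁻¹ * (diffF F)⁻¹) := by
    simp only [idealB', mul_add, mul_inv]
    congr 1
    field_simp
  have hB : (𝔫 : FractionalIdeal (𝓞 F)⁰ F) * idealB F 𝔠 a c +
      spanSingleton (𝓞 F)⁰ c * (𝔠⁻¹ * (diffF F)⁻¹) =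
      𝔫 * spanSingleton (𝓞 F)⁰ a + spanSingleton (𝓞 F)⁰ c * (𝔠⁻¹ * (diffF F)⁻¹) := by
    rw [idealB, mul_add, add_assoc]
    congr 1
    rw [← sup_eq_add, sup_eq_right]
    exact mul_le_of_le_one_left' coeIdeal_le_one
  rw [hB', ← hB, add_mul]
  by_cases h : idealB F 𝔠 a c = 0
  · simp [h]
  · rw [mul_inv]
    congr 1 <;> field_simp
end

section
/- Let 𝔟 be a nonzero fractional ideal, 𝔞 := 𝔟𝔠, and L := 𝔟 ⊕ 𝔞* ⊆ F², viewed as row vectors. Call a class of (x, y) ∈ 𝔫⁻¹𝔟 × 𝔫⁻¹𝔞* in the quotient 𝔬-module 𝔫⁻¹L/L primitive if x𝔫𝔟⁻¹ + y𝔫𝔞𝔡 + 𝔫 = 𝔬. Let G⁺(𝔟⊕𝔞*) be the group of matrices (α β; γ δ) ∈ GL₂(F) with α, δ ∈ 𝔬, β ∈ (𝔠𝔟²)*, γ ∈ 𝔠𝔡𝔟², and determinant in E, acting on 𝔫⁻¹L/L by right multiplication of row vectors. Then G⁺(𝔟⊕𝔞*) acts transitively on the set of primitive classes of 𝔫⁻¹L/L.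 -/
open NumberField FractionalIdeal
open scoped nonZeroDivisors

variable (F : Type*) [Field F] [NumberField F]

/-- The group `G⁺(𝔟 ⊕ 𝔞*)` (with `𝔞 = 𝔟𝔠`): matrices `(α β; γ δ) ∈ GL₂(F)`
with `α, δ ∈ 𝔬`, `β ∈ (𝔠𝔟²)*`, `γ ∈ 𝔠𝔡𝔟²` and determinant in `E`. -/
noncomputable def GPlusL (𝔠 𝔟 : FractionalIdeal (𝓞 F)⁰ F) (E : Subgroup (𝓞 F)ˣ) :
    Set (Matrix (Fin 2) (Fin 2) F) :=
  {γ | γ 0 0 ∈ (1 : FractionalIdeal (𝓞 F)⁰ F) ∧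
       γ 0 1 ∈ (𝔠 * 𝔟 ^ 2)⁻¹ * (diffF F)⁻¹ ∧
       γ 1 0 ∈ 𝔠 * diffF F * 𝔟 ^ 2 ∧
       γ 1 1 ∈ (1 : FractionalIdeal (𝓞 F)⁰ F) ∧
       ∃ u ∈ E, ((u : 𝓞 F) : F) = γ.det}

/-- A pair `(x, y) ∈ 𝔫⁻¹𝔟 × 𝔫⁻¹𝔞*` is primitive (i.e. its class in `𝔫⁻¹L/L`,
`L = 𝔟 ⊕ 𝔞*`, is a primitive vector of this `𝔬/𝔫`-module) if
`x𝔫𝔟⁻¹ + y𝔫𝔞𝔡 + 𝔫 = 𝔬`. -/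
noncomputable def IsPrimitivePair (𝔟 𝔞 : FractionalIdeal (𝓞 F)⁰ F)
    (𝔫 : Ideal (𝓞 F)) (x y : F) : Prop :=
  x ∈ (𝔫 : FractionalIdeal (𝓞 F)⁰ F)⁻¹ * 𝔟 ∧
  y ∈ (𝔫 : FractionalIdeal (𝓞 F)⁰ F)⁻¹ * (𝔞⁻¹ * (diffF F)⁻¹) ∧
  spanSingleton (𝓞 F)⁰ x * ((𝔫 : FractionalIdeal (𝓞 F)⁰ F) * 𝔟⁻¹) +
    spanSingleton (𝓞 F)⁰ y * ((𝔫 : FractionalIdeal (𝓞 F)⁰ F) * 𝔞 * diffF F) +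
    (𝔫 : FractionalIdeal (𝓞 F)⁰ F) = 1

section RowVectors

variable {R K : Type*} [CommRing R] [Field K] [Algebra R K]

namespace FractionalIdeal

instance instAddSubgroupClass {R P : Type*} [CommRing R] [CommRing P] [Algebra R P]
    {S : Submonoid R} : AddSubgroupClass (FractionalIdeal S P) P where
  add_mem {I} _ _ hx hy := (I : Submodule R P).add_mem hx hy
  zero_mem I := (I : Submodule R P).zero_mem
  neg_mem {I} _ hx := (I : Submodule R P).neg_mem hx

theorem mul_mem_of_eq {I J L : FractionalIdeal R⁰ K} (h : I * J = L) {u v : K} (hu : u ∈ I)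
    (hv : v ∈ J) : u * v ∈ L :=
  h ▸ mul_mem_mul hu hv

variable [IsFractionRing R K]

theorem spanSingleton_le_add_sub (x y : K) :
    spanSingleton R⁰ x ≤ spanSingleton R⁰ y + spanSingleton R⁰ (y - x) := by
  rw [spanSingleton_le_iff_mem, mem_add]
  exact ⟨y, mem_spanSingleton_self _ _, -(y - x), neg_mem (mem_spanSingleton_self _ _), by ring⟩

end FractionalIdeal

variable [IsFractionRing R K] [IsDedekindDomain R]

/-- If `I + J + N = R`, there is an ideal `M` such that `H + N = R` for every `H` which agrees
with `I` up to `J * G`, as soon as `G` generates `M` modulo `N * M`. -/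
theorem Ideal.exists_forall_sup_eq_top {I J N : Ideal R} (hN : N ≠ ⊥) (h : I ⊔ J ⊔ N = ⊤) :
    ∃ M : Ideal R, M ≠ ⊥ ∧ ∀ G H : Ideal R, N * M ⊔ G = M →
      I ≤ H ⊔ J * G → J * G ≤ H ⊔ I → H ⊔ N = ⊤ := by
  classical
  set s := (UniqueFactorizationMonoid.normalizedFactors N).filter (fun P => ¬ I ≤ P) with hs
  have hmem : ∀ P : Ideal R, P ∈ s ↔ (P.IsPrime ∧ N ≤ P) ∧ ¬ I ≤ P := fun P => by
    rw [hs, Multiset.mem_filter, Ideal.mem_normalizedFactors_iff hN]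
  have hbot : ∀ P ∈ s, P ≠ ⊥ := fun P hP hP' =>
    hN (le_bot_iff.mp (hP' ▸ ((hmem P).mp hP).1.2))
  refine ⟨s.prod, fun h0 => ?_, fun G H hG hI hJ => ?_⟩
  · exact hbot _ (Multiset.prod_eq_zero_iff.mp h0) rfl
  by_contra hHN
  obtain ⟨P, hP, hle⟩ := Ideal.exists_le_maximal _ hHN
  obtain ⟨hHP, hNP⟩ := sup_le_iff.mp hle
  by_cases hIP : I ≤ P
  · rcases hP.isPrime.mul_le.mp (hJ.trans (sup_le hHP hIP)) with hJP | hGP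
    · exact hP.ne_top (top_le_iff.mp (h ▸ sup_le (sup_le hIP hJP) hNP))
    · have hM : s.prod ≤ P := hG ▸ sup_le (Ideal.mul_le_left.trans hNP) hGP
      obtain ⟨Q, hQ, hQP⟩ := hP.isPrime.multiset_prod_le.mp hM
      have hQ' := (hmem Q).mp hQ
      have := (hQ'.1.1.isMaximal (hbot Q hQ)).eq_of_le hP.ne_top hQP
      exact hQ'.2 (this ▸ hIP)
  · have hM : s.prod ≤ P :=
      hP.isPrime.multiset_prod_le.mpr ⟨P, (hmem P).mpr ⟨⟨hP.isPrime, hNP⟩, hIP⟩, le_rfl⟩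
    have hGP : G ≤ P := (le_sup_right.trans hG.le).trans hM
    exact hIP (hI.trans (sup_le hHP (Ideal.mul_le_right.trans hGP)))

namespace FractionalIdeal

/-- `x` generates `N⁻¹ A / A`. -/
def IsGeneratorMod (N : Ideal R) (A : FractionalIdeal R⁰ K) (x : K) : Prop :=
  spanSingleton R⁰ x * (N * A⁻¹) + N = 1

/-- A primitive pair becomes a generator in the first coordinate after a suitable
transvection. -/
theorem exists_isGeneratorMod_add_mul {N : Ideal R} (hN : N ≠ ⊥) {A B : FractionalIdeal R⁰ K}
    (hA : A ≠ 0) (hB : B ≠ 0) {x y : K}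
    (h : spanSingleton R⁰ x * (N * A⁻¹) + spanSingleton R⁰ y * (N * B⁻¹) +
      (N : FractionalIdeal R⁰ K) = 1) :
    ∃ g ∈ A * B⁻¹, IsGeneratorMod N A (x + y * g) := by
  obtain ⟨I, hI⟩ := le_one_iff_exists_coeIdeal.mp
    ((le_self_add.trans le_self_add).trans h.le :
      spanSingleton R⁰ x * (N * A⁻¹) ≤ 1)
  obtain ⟨J, hJ⟩ := le_one_iff_exists_coeIdeal.mp
    ((le_add_self.trans le_self_add).trans h.le :
      spanSingleton R⁰ y * (N * B⁻¹) ≤ 1)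
  have hIJN : I ⊔ J ⊔ N = ⊤ := by
    rw [← coeIdeal_inj (K := K), coeIdeal_sup, coeIdeal_sup, hI, hJ, h, coeIdeal_top]
  obtain ⟨M, hM, hMH⟩ := Ideal.exists_forall_sup_eq_top hN hIJN
  obtain ⟨g, hg⟩ := IsDedekindDomain.exists_add_spanSingleton_mul_eq
    (a := ((N * M : Ideal R) : FractionalIdeal R⁰ K)) (b := A⁻¹ * B) (c := M)
    ((coeIdeal_le_coeIdeal K).mpr Ideal.mul_le_right)
    (coeIdeal_ne_zero.mpr (mul_ne_zero hN hM)) (mul_ne_zero (inv_ne_zero hA) hB)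
  have hgM : spanSingleton R⁰ g * (A⁻¹ * B) ≤ M := le_add_self.trans hg.le
  obtain ⟨G, hG⟩ := le_one_iff_exists_coeIdeal.mp (hgM.trans coeIdeal_le_one)
  have hJG : spanSingleton R⁰ (y * g) * (N * A⁻¹) =
      ((J * G : Ideal R) : FractionalIdeal R⁰ K) := by
    rw [coeIdeal_mul, hJ, hG, ← spanSingleton_mul_spanSingleton]
    field_simp
  have hle : ∀ a b : K, spanSingleton R⁰ a * (N * A⁻¹) ≤
      spanSingleton R⁰ b * (N * A⁻¹) + spanSingleton R⁰ (b - a) * (N * A⁻¹) := fun a b => by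
    rw [← add_mul]
    exact mul_le_mul_left (spanSingleton_le_add_sub a b) _
  have hneg : ∀ a : K, spanSingleton R⁰ (-a) = spanSingleton R⁰ a := fun a => by
    apply le_antisymm <;> rw [spanSingleton_le_iff_mem]
    · exact neg_mem (mem_spanSingleton_self _ _)
    · simpa using neg_mem (mem_spanSingleton_self R⁰ (-a))
  have hH1 := hle (x + y * g) x
  rw [show x - (x + y * g) = -(y * g) by ring, hneg, hJG, ← hI, ← coeIdeal_sup] at hH1
  obtain ⟨H, hH⟩ := le_one_iff_exists_coeIdeal.mp (hH1.trans coeIdeal_le_one)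
  have h1 := hle x (x + y * g)
  rw [add_sub_cancel_left, hJG, ← hI, ← hH, ← coeIdeal_sup, coeIdeal_le_coeIdeal] at h1
  have h2 := hle (y * g) (x + y * g)
  rw [add_sub_cancel_right, hJG, ← hI, ← hH, ← coeIdeal_sup, coeIdeal_le_coeIdeal] at h2
  refine ⟨g, ?_, ?_⟩
  · rw [← spanSingleton_le_iff_mem]
    have := mul_le_mul_left (hgM.trans coeIdeal_le_one) (A * B⁻¹)
    rw [one_mul] at this
    refine le_of_eq_of_le ?_ this
    field_simp
  · have hNG : N * M ⊔ G = M := by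
      rw [← coeIdeal_inj (K := K), coeIdeal_sup, hG, hg]
    rw [IsGeneratorMod, ← hH, ← coeIdeal_sup, hMH G H hNG h1 h2, coeIdeal_top]

/-- If `x` generates `N⁻¹ A / A`, its multiples by `B * A⁻¹` exhaust `N⁻¹ B / B`. -/
theorem IsGeneratorMod.exists_mul_sub_mem {N : Ideal R} (hN : N ≠ ⊥)
    {A B : FractionalIdeal R⁰ K} {x z : K} (hx : IsGeneratorMod N A x)
    (hz : z ∈ (N : FractionalIdeal R⁰ K)⁻¹ * B) :
    ∃ g ∈ B * A⁻¹, x * g - z ∈ B := by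
  have hN' : (N : FractionalIdeal R⁰ K) ≠ 0 := coeIdeal_ne_zero.mpr hN
  have key : spanSingleton R⁰ x * (B * A⁻¹) + B = (N : FractionalIdeal R⁰ K)⁻¹ * B := by
    have := congr((N : FractionalIdeal R⁰ K)⁻¹ * B * $hx)
    rw [mul_one] at this
    rw [← this]
    field_simp
  rw [← key, mem_add] at hz
  obtain ⟨i, hi, j, hj, rfl⟩ := hz
  obtain ⟨g, hg, rfl⟩ := mem_singleton_mul.mp hi
  exact ⟨g, hg, by simpa using neg_mem hj⟩

/-- Equivalence of row vectors modulo `A ⊕ B` under the matrices of determinant one which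
stabilise `A ⊕ B`. -/
def SpecialEquiv (A B : FractionalIdeal R⁰ K) (x y x' y' : K) : Prop :=
  ∃ a ∈ (1 : FractionalIdeal R⁰ K), ∃ b ∈ B * A⁻¹, ∃ c ∈ A * B⁻¹,
    ∃ d ∈ (1 : FractionalIdeal R⁰ K), a * d - b * c = 1 ∧
      x * a + y * c - x' ∈ A ∧ x * b + y * d - y' ∈ B

variable {A B : FractionalIdeal R⁰ K} {x y x' y' x'' y'' : K}

theorem SpecialEquiv.symm (hA : A ≠ 0) (hB : B ≠ 0) (h : SpecialEquiv A B x y x' y') :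
    SpecialEquiv A B x' y' x y := by
  obtain ⟨a, ha, b, hb, c, hc, d, hd, hdet, h1, h2⟩ := h
  refine ⟨d, hd, -b, neg_mem hb, -c, neg_mem hc, a, ha, by linear_combination hdet, ?_, ?_⟩
  · have e1 := mul_mem_of_eq (mul_one A) h1 hd
    have e2 := mul_mem_of_eq (L := A) (by field_simp) h2 hc
    convert sub_mem e2 e1 using 1
    linear_combination x * hdet
  · have e1 := mul_mem_of_eq (L := B) (by field_simp) h1 hb
    have e2 := mul_mem_of_eq (mul_one B) h2 ha
    convert sub_mem e1 e2 using 1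
    linear_combination y * hdet

theorem SpecialEquiv.trans (hA : A ≠ 0) (hB : B ≠ 0) (h : SpecialEquiv A B x y x' y')
    (h' : SpecialEquiv A B x' y' x'' y'') : SpecialEquiv A B x y x'' y'' := by
  obtain ⟨a, ha, b, hb, c, hc, d, hd, hdet, h1, h2⟩ := h
  obtain ⟨a', ha', b', hb', c', hc', d', hd', hdet', h1', h2'⟩ := h'
  refine ⟨a * a' + b * c', add_mem (mul_mem_of_eq (one_mul 1) ha ha')
      (mul_mem_of_eq (by field_simp) hb hc'),
    a * b' + b * d', add_mem (mul_mem_of_eq (one_mul _) ha hb')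
      (mul_mem_of_eq (mul_one _) hb hd'),
    c * a' + d * c', add_mem (mul_mem_of_eq (mul_one _) hc ha')
      (mul_mem_of_eq (one_mul _) hd hc'),
    c * b' + d * d', add_mem (mul_mem_of_eq (by field_simp) hc hb')
      (mul_mem_of_eq (one_mul _) hd hd'),
    by linear_combination (a' * d' - b' * c') * hdet + hdet', ?_, ?_⟩
  · have e1 := mul_mem_of_eq (mul_one A) h1 ha'
    have e2 := mul_mem_of_eq (L := A) (by field_simp) h2 hc'
    convert add_mem (add_mem e1 e2) h1' using 1
    ring
  · have e1 := mul_mem_of_eq (L := B) (by field_simp) h1 hb'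
    have e2 := mul_mem_of_eq (mul_one B) h2 hd'
    convert add_mem (add_mem e1 e2) h2' using 1
    ring

theorem SpecialEquiv.of_fst {c : K} (hc : c ∈ A * B⁻¹) (h : x + y * c - x' ∈ A) :
    SpecialEquiv A B x y x' y :=
  ⟨1, one_mem_one _, 0, zero_mem _, c, hc, 1, one_mem_one _, by ring, by simpa using h, by simp⟩

theorem SpecialEquiv.of_snd {b : K} (hb : b ∈ B * A⁻¹) (h : y + x * b - y' ∈ B) :
    SpecialEquiv A B x y x y' :=
  ⟨1, one_mem_one _, b, hb, 0, zero_mem _, 1, one_mem_one _, by ring, by simp, by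
    simpa [add_comm] using h⟩

/-- Primitive pairs are equivalent to pairs with prescribed second coordinate and a generator
in the first. -/
theorem SpecialEquiv.of_isGeneratorMod {N : Ideal R} (hN : N ≠ ⊥) (hA : A ≠ 0) (hB : B ≠ 0)
    (hx : x ∈ (N : FractionalIdeal R⁰ K)⁻¹ * A) (hx' : x' ∈ (N : FractionalIdeal R⁰ K)⁻¹ * A)
    (hy : y ∈ (N : FractionalIdeal R⁰ K)⁻¹ * B) (hy' : y' ∈ (N : FractionalIdeal R⁰ K)⁻¹ * B)
    (h : IsGeneratorMod N A x) (h' : IsGeneratorMod N A x') :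
    SpecialEquiv A B x y x' y' := by
  have hN' : (N : FractionalIdeal R⁰ K) ≠ 0 := coeIdeal_ne_zero.mpr hN
  have hyx : spanSingleton R⁰ y * (N * B⁻¹) + spanSingleton R⁰ x * (N * A⁻¹) +
      (N : FractionalIdeal R⁰ K) = 1 := by
    rw [add_assoc, h, ← sup_eq_add, sup_eq_right]
    refine (mul_le_mul_left (spanSingleton_le_iff_mem.mpr hy) _).trans_eq ?_
    field_simp
  obtain ⟨b, hb, hgen⟩ := exists_isGeneratorMod_add_mul hN hB hA hyx
  have hxb : x * b ∈ (N : FractionalIdeal R⁰ K)⁻¹ * B :=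
    mul_mem_of_eq (by field_simp) hx hb
  obtain ⟨c, hc, hcx⟩ := hgen.exists_mul_sub_mem hN (sub_mem hx' hx)
  obtain ⟨b', hb', hby⟩ := h'.exists_mul_sub_mem hN (sub_mem hy' (add_mem hy hxb))
  refine ((SpecialEquiv.of_snd (y' := y + x * b) hb (by simp)).trans hA hB
    (.of_fst hc ?_)).trans hA hB (.of_snd hb' ?_)
  · convert hcx using 1
    ring
  · convert hby using 1
    ring

/-- Any two primitive vectors of `N⁻¹(A ⊕ B)/(A ⊕ B)` are equivalent. -/
theorem SpecialEquiv.of_primitive {N : Ideal R} (hN : N ≠ ⊥) (hA : A ≠ 0) (hB : B ≠ 0)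
    (hx : x ∈ (N : FractionalIdeal R⁰ K)⁻¹ * A) (hx' : x' ∈ (N : FractionalIdeal R⁰ K)⁻¹ * A)
    (hy : y ∈ (N : FractionalIdeal R⁰ K)⁻¹ * B) (hy' : y' ∈ (N : FractionalIdeal R⁰ K)⁻¹ * B)
    (h : spanSingleton R⁰ x * (N * A⁻¹) + spanSingleton R⁰ y * (N * B⁻¹) +
      (N : FractionalIdeal R⁰ K) = 1)
    (h' : spanSingleton R⁰ x' * (N * A⁻¹) + spanSingleton R⁰ y' * (N * B⁻¹) +
      (N : FractionalIdeal R⁰ K) = 1) :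
    SpecialEquiv A B x y x' y' := by
  have hN' : (N : FractionalIdeal R⁰ K) ≠ 0 := coeIdeal_ne_zero.mpr hN
  obtain ⟨c, hc, hgen⟩ := exists_isGeneratorMod_add_mul hN hA hB h
  obtain ⟨c', hc', hgen'⟩ := exists_isGeneratorMod_add_mul hN hA hB h'
  have hyc := mul_mem_of_eq (L := (N : FractionalIdeal R⁰ K)⁻¹ * A) (by field_simp) hy hc
  have hyc' := mul_mem_of_eq (L := (N : FractionalIdeal R⁰ K)⁻¹ * A) (by field_simp) hy' hc'
  have e := SpecialEquiv.of_fst (x := x) (y := y) (x' := x + y * c) hc (by simp)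
  have e' := SpecialEquiv.of_fst (x := x') (y := y') (x' := x' + y' * c') hc' (by simp)
  exact (e.trans hA hB (.of_isGeneratorMod hN hA hB (add_mem hx hyc) (add_mem hx' hyc') hy hy'
    hgen hgen')).trans hA hB (e'.symm hA hB)

end FractionalIdeal

end RowVectors

/-- `G⁺(𝔟⊕𝔞*)` acts transitively on the primitive classes of `𝔫⁻¹L/L`
(`L = 𝔟 ⊕ 𝔞*`, `𝔞 = 𝔟𝔠`, row vectors, right multiplication): any two
primitive pairs are related by an element of `G⁺(𝔟⊕𝔞*)` modulo `L`. -/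
theorem stmt12
    (htotreal : ∀ φ : F →+* ℂ, ComplexEmbedding.IsReal φ)
    (𝔠 : FractionalIdeal (𝓞 F)⁰ F) (h𝔠 : 𝔠 ≠ 0)
    (𝔫 : Ideal (𝓞 F)) (h𝔫 : 𝔫 ≠ 0)
    (E : Subgroup (𝓞 F)ˣ)
    (hE : ∀ u ∈ E, ∀ φ : F →+* ℝ, 0 < φ ((u : 𝓞 F) : F))
    (𝔟 : FractionalIdeal (𝓞 F)⁰ F) (h𝔟 : 𝔟 ≠ 0) :
    ∀ x y x' y' : F,
      IsPrimitivePair F 𝔟 (𝔟 * 𝔠) 𝔫 x y →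
      IsPrimitivePair F 𝔟 (𝔟 * 𝔠) 𝔫 x' y' →
      ∃ γ ∈ GPlusL F 𝔠 𝔟 E,
        Matrix.vecMul ![x, y] γ 0 - x' ∈ 𝔟 ∧
        Matrix.vecMul ![x, y] γ 1 - y' ∈ (𝔟 * 𝔠)⁻¹ * (diffF F)⁻¹ := by
  rintro x y x' y' ⟨hx, hy, h⟩ ⟨hx', hy', h'⟩
  have hd : diffF F ≠ 0 := coeIdeal_ne_zero.mpr differentIdeal_ne_bot
  have hB : (𝔟 * 𝔠)⁻¹ * (diffF F)⁻¹ ≠ 0 := by simp [h𝔟, h𝔠, hd]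
  have hBinv : (𝔫 : FractionalIdeal (𝓞 F)⁰ F) * (𝔟 * 𝔠) * diffF F =
      𝔫 * ((𝔟 * 𝔠)⁻¹ * (diffF F)⁻¹)⁻¹ := by
    field_simp
  rw [hBinv] at h h'
  obtain ⟨a, ha, b, hb, c, hc, d, hd', hdet, h1, h2⟩ :=
    SpecialEquiv.of_primitive h𝔫 h𝔟 hB hx hx' hy hy' h h'
  refine ⟨!![a, b; c, d], ⟨ha, ?_, ?_, hd', 1, one_mem E, ?_⟩, ?_, ?_⟩
  · convert hb using 1
    · field_simp
    · rfl
  · convert hc using 1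
    · field_simp
    · rfl
  · simp [Matrix.det_fin_two, hdet]
  · simpa [Matrix.vecMul, dotProduct, Fin.sum_univ_two] using h1
  · simpa [Matrix.vecMul, dotProduct, Fin.sum_univ_two] using h2
end

section
/- Let 𝔞, 𝔟, 𝔟' be nonzero fractional ideals of F with 𝔟 ⊆ 𝔟' ⊆ 𝔫⁻¹𝔟. Then the map sending x ∈ (𝔞𝔟)* to the 𝔬-linear homomorphism 𝔟'/𝔟 → 𝔫⁻¹𝔞*/𝔞*, (β mod 𝔟) ↦ (xβ mod 𝔞*), is a well-defined 𝔬-module homomorphism (𝔞𝔟)* → Hom_𝔬(𝔟'/𝔟, 𝔫⁻¹𝔞*/𝔞*) with kernel exactly (𝔞𝔟')*, and it induces an isomorphism of 𝔬-modules (𝔞𝔟)*/(𝔞𝔟')* ≅ Hom_𝔬(𝔟'/𝔟, 𝔫⁻¹𝔞*/𝔞*). -/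
open NumberField FractionalIdeal
open scoped nonZeroDivisors

variable (F : Type*) [Field F] [NumberField F]

/-- The quotient `𝔬`-module `P/N` of two fractional ideals `N ⊆ P` of `F`
(realized as the quotient of `P` by the pullback of `N`). -/
noncomputable abbrev FIQuot (N P : FractionalIdeal (𝓞 F)⁰ F) : Type _ :=
  ↥(P : Submodule (𝓞 F) F) ⧸
    ((N : Submodule (𝓞 F) F).comap (P : Submodule (𝓞 F) F).subtype)

theorem FractionalIdeal.mem_mul_inv_iff {A K : Type*} [CommRing A] [IsDedekindDomain A]
    [Field K] [Algebra A K] [IsFractionRing A K] {I J : FractionalIdeal A⁰ K} (hJ : J ≠ 0)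
    {x : K} :
    x ∈ J⁻¹ * I ↔ ∀ y ∈ J, x * y ∈ I := by
  rw [mul_comm, ← div_eq_mul_inv, FractionalIdeal.mem_div_iff_of_ne_zero hJ]

theorem FractionalIdeal.projective_of_ne_zero {A K : Type*} [CommRing A] [IsDedekindDomain A]
    [Field K] [Algebra A K] [IsFractionRing A K] {I : FractionalIdeal A⁰ K} (hI : I ≠ 0) :
    Module.Projective A (I : Submodule A K) := by
  have h : IsUnit (I : Submodule A K) :=
    (isUnit_iff_ne_zero.mpr hI).map (FractionalIdeal.coeSubmoduleHom A⁰ K)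
  exact Submodule.projective_of_isUnit h

/-- Linear maps between submodules of a fraction field are given by multiplication. -/
theorem LinearMap.mul_apply_comm_of_isFractionRing {A K : Type*} [CommRing A] [IsDomain A]
    [Field K] [Algebra A K] [IsFractionRing A K] {P : Submodule A K} (f : P →ₗ[A] K) (y z : P) :
    f y * z = f z * y := by
  obtain ⟨a, s, hs, hy⟩ := IsFractionRing.div_surjective (A := A) (y : K)
  obtain ⟨c, t, ht, hz⟩ := IsFractionRing.div_surjective (A := A) (z : K)
  have hs' : algebraMap A K s ≠ 0 := IsFractionRing.to_map_ne_zero_of_mem_nonZeroDivisors hs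
  have ht' : algebraMap A K t ≠ 0 := IsFractionRing.to_map_ne_zero_of_mem_nonZeroDivisors ht
  have h : (c * s) • y = (a * t) • z := by
    ext
    simp only [Submodule.coe_smul, Algebra.smul_def, map_mul, ← hy, ← hz]
    field_simp
  have h2 := congrArg f h
  simp only [map_smul, Algebra.smul_def, map_mul] at h2
  rw [← hy, ← hz]
  field_simp
  linear_combination h2

/-- Multiplication induces an isomorphism
`(𝔞𝔟)*/(𝔞𝔟')* ≅ Hom_𝔬(𝔟'/𝔟, 𝔫⁻¹𝔞*/𝔞*)`: the `𝔬`-linear map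
`Φ : (𝔞𝔟)* → Hom_𝔬(𝔟'/𝔟, 𝔫⁻¹𝔞*/𝔞*)`, `x ↦ (β mod 𝔟 ↦ xβ mod 𝔞*)`, is well
defined, has kernel exactly `(𝔞𝔟')*`, and is surjective. -/
theorem stmt14
    (htotreal : ∀ φ : F →+* ℂ, ComplexEmbedding.IsReal φ)
    (𝔫 : Ideal (𝓞 F)) (h𝔫 : 𝔫 ≠ 0)
    (𝔞 𝔟 𝔟' : FractionalIdeal (𝓞 F)⁰ F)
    (h𝔞 : 𝔞 ≠ 0) (h𝔟 : 𝔟 ≠ 0) (h𝔟' : 𝔟' ≠ 0)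
    (hbb' : 𝔟 ≤ 𝔟') (hb'n : 𝔟' ≤ (𝔫 : FractionalIdeal (𝓞 F)⁰ F)⁻¹ * 𝔟) :
    ∃ Φ : ↥(((𝔞 * 𝔟)⁻¹ * (diffF F)⁻¹ : FractionalIdeal (𝓞 F)⁰ F) :
        Submodule (𝓞 F) F) →ₗ[𝓞 F]
      (FIQuot F 𝔟 𝔟' →ₗ[𝓞 F]
        FIQuot F (𝔞⁻¹ * (diffF F)⁻¹)
          ((𝔫 : FractionalIdeal (𝓞 F)⁰ F)⁻¹ * (𝔞⁻¹ * (diffF F)⁻¹))),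
      -- `Φ x` sends the class of `β` to the class of `xβ`
      (∀ (x : ↥(((𝔞 * 𝔟)⁻¹ * (diffF F)⁻¹ : FractionalIdeal (𝓞 F)⁰ F) :
            Submodule (𝓞 F) F))
         (β : F) (hβ : β ∈ (𝔟' : Submodule (𝓞 F) F)),
        ∃ h' : (x : F) * β ∈
            (((𝔫 : FractionalIdeal (𝓞 F)⁰ F)⁻¹ * (𝔞⁻¹ * (diffF F)⁻¹) :
              FractionalIdeal (𝓞 F)⁰ F) : Submodule (𝓞 F) F),
          Φ x (Submodule.Quotient.mk ⟨β, hβ⟩) =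
            Submodule.Quotient.mk ⟨(x : F) * β, h'⟩) ∧
      -- the kernel of `Φ` is exactly `(𝔞𝔟')*`
      LinearMap.ker Φ =
        Submodule.comap
          (((𝔞 * 𝔟)⁻¹ * (diffF F)⁻¹ : FractionalIdeal (𝓞 F)⁰ F) :
            Submodule (𝓞 F) F).subtype
          (((𝔞 * 𝔟')⁻¹ * (diffF F)⁻¹ : FractionalIdeal (𝓞 F)⁰ F) :
            Submodule (𝓞 F) F) ∧
      -- `Φ` is surjective, hence induces an isomorphism
      -- `(𝔞𝔟)*/(𝔞𝔟')* ≅ Hom_𝔬(𝔟'/𝔟, 𝔫⁻¹𝔞*/𝔞*)`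
      Function.Surjective Φ := by
  set 𝔠 : FractionalIdeal (𝓞 F)⁰ F := 𝔞⁻¹ * (diffF F)⁻¹ with h𝔠
  have hstar (𝔧 : FractionalIdeal (𝓞 F)⁰ F) (h𝔧 : 𝔧 ≠ 0) (x : F) :
      x ∈ (𝔞 * 𝔧)⁻¹ * (diffF F)⁻¹ ↔ ∀ y ∈ 𝔧, x * y ∈ 𝔠 := by
    rw [← FractionalIdeal.mem_mul_inv_iff h𝔧, h𝔠, mul_inv, mul_comm 𝔞⁻¹, mul_assoc]
  have hmem (x : F) (hx : x ∈ (𝔞 * 𝔟)⁻¹ * (diffF F)⁻¹) (y : F) (hy : y ∈ 𝔟') :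
      x * y ∈ (𝔫 : FractionalIdeal (𝓞 F)⁰ F)⁻¹ * 𝔠 := by
    have h := FractionalIdeal.mul_mem_mul hx (hb'n hy)
    convert h using 1
    rw [h𝔠, mul_inv]
    field_simp
  let M : Submodule (𝓞 F) F := ((𝔞 * 𝔟)⁻¹ * (diffF F)⁻¹ : FractionalIdeal (𝓞 F)⁰ F)
  let C : Submodule (𝓞 F) F :=
    ((𝔫 : FractionalIdeal (𝓞 F)⁰ F)⁻¹ * 𝔠 : FractionalIdeal (𝓞 F)⁰ F)
  let N : Submodule (𝓞 F) C := (𝔠 : Submodule (𝓞 F) F).comap C.subtype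
  let L : M →ₗ[𝓞 F] (𝔟' : Submodule (𝓞 F) F) →ₗ[𝓞 F] C :=
    LinearMap.mk₂ (𝓞 F) (fun x y => ⟨(x : F) * y, hmem x x.2 y y.2⟩)
      (fun _ _ _ => Subtype.ext (add_mul _ _ _))
      (fun _ _ _ => Subtype.ext (smul_mul_assoc _ _ _))
      (fun _ _ _ => Subtype.ext (mul_add _ _ _))
      (fun _ _ _ => Subtype.ext (mul_smul_comm _ _ _))
  let B : Submodule (𝓞 F) (𝔟' : Submodule (𝓞 F) F) :=
    (𝔟 : Submodule (𝓞 F) F).comap (𝔟' : Submodule (𝓞 F) F).subtype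
  have hker (x : M) : B ≤ LinearMap.ker (N.mkQ ∘ₗ L x) := by
    intro y hy
    rw [LinearMap.mem_ker]
    exact (Submodule.Quotient.mk_eq_zero N).mpr ((hstar 𝔟 h𝔟 x).mp x.2 y hy)
  let Φ : M →ₗ[𝓞 F] (FIQuot F 𝔟 𝔟' →ₗ[𝓞 F] (C ⧸ N)) :=
    { toFun := fun x => B.liftQ (N.mkQ ∘ₗ L x) (hker x)
      map_add' := fun x y => by
        apply Submodule.linearMap_qext
        ext z
        simp
      map_smul' := fun r x => by
        apply Submodule.linearMap_qext
        ext z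
        simp }
  refine ⟨Φ, fun x β hβ => ⟨hmem x x.2 β hβ, rfl⟩, ?_, ?_⟩
  · ext x
    rw [LinearMap.mem_ker, Submodule.mem_comap]
    refine Iff.trans ?_ (hstar 𝔟' h𝔟' x).symm
    constructor
    · intro h y hy
      have h2 : N.mkQ (L x ⟨y, hy⟩) = 0 := LinearMap.congr_fun h (B.mkQ ⟨y, hy⟩)
      exact (Submodule.Quotient.mk_eq_zero N).mp h2
    · intro h
      apply Submodule.linearMap_qext
      ext y
      exact (Submodule.Quotient.mk_eq_zero N).mpr (h y y.2)
  · intro φ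
    have := FractionalIdeal.projective_of_ne_zero h𝔟'
    obtain ⟨ψ, hψ⟩ := Module.projective_lifting_property N.mkQ (φ ∘ₗ B.mkQ) N.mkQ_surjective
    obtain ⟨z, hz, hz0⟩ := (Submodule.ne_bot_iff (𝔟' : Submodule (𝓞 F) F)).mp
      (FractionalIdeal.coeToSubmodule_ne_bot.mpr h𝔟')
    have hmul (y : (𝔟' : Submodule (𝓞 F) F)) : (ψ ⟨z, hz⟩ : F) / z * y = ψ y := by
      have h := LinearMap.mul_apply_comm_of_isFractionRing (C.subtype ∘ₗ ψ) y ⟨z, hz⟩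
      simp only [LinearMap.comp_apply, Submodule.subtype_apply] at h
      rw [div_mul_eq_mul_div, ← h, mul_div_cancel_right₀ _ hz0]
    have hx : (ψ ⟨z, hz⟩ : F) / z ∈ M := by
      refine (hstar 𝔟 h𝔟 _).mpr fun y hy => ?_
      have h1 : N.mkQ (ψ ⟨y, hbb' hy⟩) = φ (B.mkQ ⟨y, hbb' hy⟩) := LinearMap.congr_fun hψ _
      have h2 : B.mkQ ⟨y, hbb' hy⟩ = 0 := (Submodule.Quotient.mk_eq_zero B).mpr hy
      rw [h2, map_zero] at h1
      rw [hmul ⟨y, hbb' hy⟩]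
      exact (Submodule.Quotient.mk_eq_zero N).mp h1
    refine ⟨⟨_, hx⟩, ?_⟩
    apply Submodule.linearMap_qext
    rw [← hψ]
    ext y
    exact congrArg N.mkQ (Subtype.ext (hmul y))
end

section
/- Let 𝔞 and 𝔟 be nonzero fractional ideals of F. For every ℤ-bilinear map ⟨·,·⟩ : 𝔞 × 𝔟 → ℤ satisfying ⟨aα, β⟩ = ⟨α, aβ⟩ for all a ∈ 𝔬, α ∈ 𝔞, β ∈ 𝔟 (an 𝔬-balanced pairing), there exists a unique element ξ* ∈ (𝔞𝔟)* = (𝔞𝔟)⁻¹𝔡⁻¹ such that ⟨α, β⟩ = Tr_{F/ℚ}(ξ* α β) for all α ∈ 𝔞 and β ∈ 𝔟. -/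
open NumberField FractionalIdeal
open scoped nonZeroDivisors

variable (F : Type*) [Field F] [NumberField F]

/-- A nonzero fractional ideal contains a nonzero element. -/
lemma exists_ne_zero_mem_fractionalIdeal (I : FractionalIdeal (𝓞 F)⁰ F) (hI : I ≠ 0) :
    ∃ x : F, x ≠ 0 ∧ x ∈ I := by
  obtain ⟨r, hr, hrI⟩ := FractionalIdeal.exists_ne_zero_mem_isInteger hI
  exact ⟨algebraMap (𝓞 F) F r, by simpa using hr, hrI⟩

/-- Every element of a number field has a nonzero integer multiple in the ring of integers. -/
lemma exists_int_smul_eq_ringOfIntegers (x : F) :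
    ∃ n : ℤ, n ≠ 0 ∧ ∃ s : 𝓞 F, (s : F) = n * x := by
  have hx : IsAlgebraic ℤ x :=
    (IsFractionRing.isAlgebraic_iff ℤ ℚ F).mpr (Algebra.IsAlgebraic.isAlgebraic x)
  obtain ⟨n, hn, hs⟩ := hx.exists_integral_multiple
  exact ⟨n, hn, ⟨n • x, hs⟩, by simp [zsmul_eq_mul]⟩

/-- An additive map from a nonzero fractional ideal to `ℤ` is the trace pairing against some
element of the field. -/
lemma exists_eq_trace_mul (I : FractionalIdeal (𝓞 F)⁰ F) (hI : I ≠ 0)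
    (f : ↥(I : Submodule (𝓞 F) F) →+ ℤ) :
    ∃ η : F, ∀ x : ↥(I : Submodule (𝓞 F) F), (f x : ℚ) = Algebra.trace ℚ F (η * (x : F)) := by
  let B := basisOfFractionalIdeal F (Units.mk0 I hI)
  let c := fractionalIdealBasis F I
  let ℓ : F →ₗ[ℚ] ℚ := B.constr ℚ fun i => (f (c i) : ℚ)
  have hℓ : (Algebra.linearMap ℤ ℚ) ∘ₗ f.toIntLinearMap =
      ℓ.restrictScalars ℤ ∘ₗ (Submodule.subtype (I : Submodule (𝓞 F) F)).restrictScalars ℤ := by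
    refine c.ext fun i => ?_
    have h1 : ((c i : ↥(I : Submodule (𝓞 F) F)) : F) = B i :=
      (basisOfFractionalIdeal_apply F (Units.mk0 I hI) i).symm
    have h2 : ℓ (B i) = (f (c i) : ℚ) := B.constr_basis ℚ _ i
    rw [← h1] at h2
    exact h2.symm
  refine ⟨((Algebra.traceForm ℚ F).toDual (traceForm_nondegenerate ℚ F)).symm ℓ, fun x => ?_⟩
  have h := LinearMap.BilinForm.apply_toDual_symm_apply
    (hB := traceForm_nondegenerate ℚ F) ℓ (x : F)
  rw [Algebra.traceForm_apply] at h
  exact (LinearMap.congr_fun hℓ x).trans h.symm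

/-- An element of a number field is zero if its products with two nonzero fractional ideals have
trace zero. -/
lemma eq_zero_of_trace_mul_mul_eq_zero (I J : FractionalIdeal (𝓞 F)⁰ F) (hI : I ≠ 0) (hJ : J ≠ 0)
    (z : F) (hz : ∀ x ∈ I, ∀ y ∈ J, Algebra.trace ℚ F (z * x * y) = 0) : z = 0 := by
  obtain ⟨x, hx0, hx⟩ := exists_ne_zero_mem_fractionalIdeal F _ hI
  obtain ⟨y, hy0, hy⟩ := exists_ne_zero_mem_fractionalIdeal F _ hJ
  refine (traceForm_nondegenerate ℚ F).1 z fun w => ?_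
  obtain ⟨n, hn, s, hs⟩ := exists_int_smul_eq_ringOfIntegers F (w / (x * y))
  have h := hz x hx (s • y) (Submodule.smul_mem (J : Submodule (𝓞 F) F) s hy)
  have e : z * x * (s • y) = (n : ℚ) • (z * w) := by
    rw [Algebra.smul_def, Algebra.smul_def]
    change z * x * ((s : F) * y) = _
    rw [hs]
    simp
    field_simp
  rw [e, map_smul, smul_eq_mul] at h
  rw [Algebra.traceForm_apply]
  exact (mul_eq_zero.mp h).resolve_left (by exact_mod_cast hn)

lemma inv_mul_inv_diffF (I : FractionalIdeal (𝓞 F)⁰ F) :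
    I⁻¹ * (diffF F)⁻¹ = FractionalIdeal.dual ℤ ℚ I := by
  rw [diffF, coeIdeal_differentIdeal ℤ ℚ, inv_inv, mul_comm, ← FractionalIdeal.dual_eq_mul_inv]

/-- Every `ℤ`-bilinear, `𝔬`-balanced pairing `⟨·,·⟩ : 𝔞 × 𝔟 → ℤ` is of the
form `⟨α, β⟩ = Tr_{F/ℚ}(ξ* α β)` for a unique `ξ* ∈ (𝔞𝔟)* = (𝔞𝔟)⁻¹𝔡⁻¹`. -/
theorem stmt15
    (htotreal : ∀ φ : F →+* ℂ, ComplexEmbedding.IsReal φ)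
    (𝔞 𝔟 : FractionalIdeal (𝓞 F)⁰ F) (h𝔞 : 𝔞 ≠ 0) (h𝔟 : 𝔟 ≠ 0)
    (b : ↥(𝔞 : Submodule (𝓞 F) F) →+ ↥(𝔟 : Submodule (𝓞 F) F) →+ ℤ)
    (hbal : ∀ (r : 𝓞 F) (α : ↥(𝔞 : Submodule (𝓞 F) F))
      (β : ↥(𝔟 : Submodule (𝓞 F) F)), b (r • α) β = b α (r • β)) :
    ∃! ξ : F, ξ ∈ (𝔞 * 𝔟)⁻¹ * (diffF F)⁻¹ ∧
      ∀ (α : ↥(𝔞 : Submodule (𝓞 F) F)) (β : ↥(𝔟 : Submodule (𝓞 F) F)),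
        (b α β : ℚ) = Algebra.trace ℚ F (ξ * (α : F) * (β : F)) := by
  obtain ⟨x, hx0, hx⟩ := exists_ne_zero_mem_fractionalIdeal F _ h𝔞
  let α₀ : ↥(𝔞 : Submodule (𝓞 F) F) := ⟨x, hx⟩
  obtain ⟨η, hη⟩ := exists_eq_trace_mul F 𝔟 h𝔟 (b α₀)
  have key : ∀ (α : ↥(𝔞 : Submodule (𝓞 F) F)) (β : ↥(𝔟 : Submodule (𝓞 F) F)),
      (b α β : ℚ) = Algebra.trace ℚ F (η / x * (α : F) * (β : F)) := by
    intro α β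
    obtain ⟨n, hn, s, hs⟩ := exists_int_smul_eq_ringOfIntegers F ((α : F) / x)
    have hα : n • α = s • α₀ := by
      apply Subtype.ext
      change n • (α : F) = (s : F) * x
      rw [hs, zsmul_eq_mul]
      field_simp
    have h1 : n * b α β = b α₀ (s • β) := by
      rw [← hbal, ← hα, map_zsmul]
      simp
    have h2 : η * ((s • β : ↥(𝔟 : Submodule (𝓞 F) F)) : F) =
        (n : ℚ) • (η / x * (α : F) * (β : F)) := by
      change η * ((s : F) * (β : F)) = _
      rw [hs, Algebra.smul_def]
      simp
      field_simp
    have h3 := hη (s • β)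
    rw [← h1, h2, map_smul, smul_eq_mul] at h3
    push_cast at h3
    exact mul_left_cancel₀ (by exact_mod_cast hn) h3
  refine ⟨η / x, ⟨?_, key⟩, ?_⟩
  · rw [inv_mul_inv_diffF, FractionalIdeal.mem_dual (mul_ne_zero h𝔞 h𝔟)]
    intro a ha
    refine FractionalIdeal.mul_induction_on ha (fun i hi j hj => ⟨b ⟨i, hi⟩ ⟨j, hj⟩, ?_⟩)
      fun u v hu hv => ?_
    · rw [Algebra.traceForm_apply, ← mul_assoc]
      exact key ⟨i, hi⟩ ⟨j, hj⟩
    · rw [map_add]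
      exact add_mem hu hv
  · rintro ξ ⟨-, hξ⟩
    refine sub_eq_zero.mp (eq_zero_of_trace_mul_mul_eq_zero F 𝔞 𝔟 h𝔞 h𝔟 _ fun u hu v hv => ?_)
    rw [sub_mul, sub_mul, map_sub, ← hξ ⟨u, hu⟩ ⟨v, hv⟩, ← key ⟨u, hu⟩ ⟨v, hv⟩, sub_self]
end

section
/- Let F be a totally real number field of degree d_F > 1 over ℚ, with ring of integers 𝔬, and let U be a finite-index subgroup of the unit group 𝔬^×. Let ξ₀ ∈ F be a nonzero element which is not totally positive (i.e. τ₀(ξ₀) < 0 for some real embedding τ₀ of F), and let (x_τ)_{τ} be a family of strictly positive real numbers indexed by the real embeddings τ of F. Then the set of real numbers { Σ_τ τ(u)² τ(ξ₀) x_τ : u ∈ U } is not bounded below; that is, for every C ∈ ℝ there exists u ∈ U with Σ_τ τ(u)² τ(ξ₀) x_τ < C. -/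
open NumberField

/-- The infinite place `x ↦ |τ x|` attached to a real embedding `τ`. -/
noncomputable def realPlace {F : Type*} [Field F] (τ : F →+* ℝ) : InfinitePlace F :=
  InfinitePlace.mk (Complex.ofRealHom.comp τ)

theorem realPlace_apply {F : Type*} [Field F] (τ : F →+* ℝ) (y : F) :
    realPlace τ y = |τ y| := by
  simp [realPlace, InfinitePlace.apply]

theorem realPlace_injective {F : Type*} [Field F] :
    Function.Injective (realPlace : (F →+* ℝ) → InfinitePlace F) := by
  intro σ τ h
  ext y
  rcases InfinitePlace.mk_eq_iff.mp h with h | h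
  · simpa using RingHom.congr_fun h y
  · simpa [ComplexEmbedding.conjugate_coe_eq] using RingHom.congr_fun h y

open Units Units.dirichletUnitTheorem in
/-- A unit in a finite-index subgroup that is small at every place but one, where it is large. -/
theorem exists_unit_mem_lt_one (F : Type*) [Field F] [NumberField F]
    (hcard : 1 < Fintype.card (InfinitePlace F)) (U : Subgroup (𝓞 F)ˣ) (hU : U.FiniteIndex)
    (w₁ : InfinitePlace F) :
    ∃ u ∈ U, 1 < w₁ ((u : 𝓞 F) : F) ∧ ∀ w ≠ w₁, w ((u : 𝓞 F) : F) < 1 := by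
  obtain ⟨v, hv⟩ := exists_unit F w₁
  have hpos (w : InfinitePlace F) : 0 < w ((v : 𝓞 F) : F) := pos_at_place v w
  have hsmall (w : InfinitePlace F) (hw : w ≠ w₁) : w ((v : 𝓞 F) : F) < 1 :=
    (Real.log_neg_iff (hpos w)).mp (hv w hw)
  have hmult (w : InfinitePlace F) : (0 : ℝ) < w.mult := by exact_mod_cast w.mult_pos
  have hlarge : 1 < w₁ ((v : 𝓞 F) : F) := by
    by_contra! hle
    obtain ⟨w₂, hw₂⟩ := Fintype.exists_ne_of_one_lt_card hcard w₁
    have hsum : ∑ w : InfinitePlace F, w.mult * Real.log (w ((v : 𝓞 F) : F)) < 0 := by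
      refine Finset.sum_neg' (fun w _ ↦ ?_)
        ⟨w₂, Finset.mem_univ _, mul_neg_of_pos_of_neg (hmult w₂) (hv w₂ hw₂)⟩
      refine mul_nonpos_of_nonneg_of_nonpos (hmult w).le (Real.log_nonpos (hpos w).le ?_)
      rcases eq_or_ne w w₁ with rfl | hw
      exacts [hle, (hsmall w hw).le]
    exact hsum.ne (sum_mult_mul_log v)
  have hindex : U.index ≠ 0 := hU.index_ne_zero
  refine ⟨v ^ U.index, U.pow_index_mem v, ?_, fun w hw ↦ ?_⟩
  · simpa using one_lt_pow₀ hlarge hindex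
  · simpa using pow_lt_one₀ (hpos w).le (hsmall w hw) hindex

/-- The analytic core of the Koecher principle: if `F` is a totally real
number field of degree `> 1`, `U` is a finite-index subgroup of `𝔬^×`,
`ξ₀ ≠ 0` is not totally positive, and `(x_τ)_τ` are strictly positive reals
indexed by the real embeddings of `F`, then `{ Σ_τ τ(u)² τ(ξ₀) x_τ : u ∈ U }`
is not bounded below. -/
theorem stmt16 (F : Type*) [Field F] [NumberField F]
    (htotreal : ∀ φ : F →+* ℂ, ComplexEmbedding.IsReal φ)
    (hdeg : 1 < Module.finrank ℚ F)
    (U : Subgroup (𝓞 F)ˣ) (hU : U.FiniteIndex)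
    (ξ₀ : F) (hξ₀ : ξ₀ ≠ 0)
    (τ₀ : F →+* ℝ) (hτ₀ : τ₀ ξ₀ < 0)
    (x : (F →+* ℝ) → ℝ) (hx : ∀ τ : F →+* ℝ, 0 < x τ) :
    ∀ C : ℝ, ∃ u ∈ U,
      ∑ τ : F →+* ℝ, (τ ((u : 𝓞 F) : F)) ^ 2 * τ ξ₀ * x τ < C := by
  classical
  have : IsTotallyReal F :=
    ⟨fun w ↦ InfinitePlace.isReal_iff.mpr (htotreal w.embedding)⟩
  obtain ⟨ε, hεU, hlarge, hsmall⟩ := exists_unit_mem_lt_one F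
    (by rwa [InfinitePlace.card_eq_nrRealPlaces_add_nrComplexPlaces,
      IsTotallyReal.nrComplexPlaces_eq_zero, add_zero, ← IsTotallyReal.finrank]) U hU (realPlace τ₀)
  rw [realPlace_apply] at hlarge
  intro C
  set B : ℝ := ∑ τ ∈ Finset.univ.erase τ₀, |τ ξ₀| * x τ
  have hneg : 0 < -(τ₀ ξ₀ * x τ₀) := neg_pos.mpr (mul_neg_of_neg_of_pos hτ₀ (hx τ₀))
  obtain ⟨n, hn⟩ := pow_unbounded_of_one_lt ((B - C) / -(τ₀ ξ₀ * x τ₀))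
    (one_lt_pow₀ hlarge two_ne_zero)
  rw [div_lt_iff₀ hneg, sq_abs] at hn
  refine ⟨ε ^ n, U.pow_mem hεU n, ?_⟩
  have hrest : ∑ τ ∈ Finset.univ.erase τ₀,
      (τ (((ε ^ n : (𝓞 F)ˣ) : 𝓞 F) : F)) ^ 2 * τ ξ₀ * x τ ≤ B := by
    refine Finset.sum_le_sum fun τ hτ ↦ mul_le_mul_of_nonneg_right ?_ (hx τ).le
    have hτε := hsmall (realPlace τ) (realPlace_injective.ne (Finset.ne_of_mem_erase hτ))
    rw [realPlace_apply] at hτε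
    have hsq : (τ (((ε ^ n : (𝓞 F)ˣ) : 𝓞 F) : F)) ^ 2 ≤ 1 := by
      rw [sq_le_one_iff_abs_le_one]
      simpa using pow_le_one₀ (n := n) (abs_nonneg _) hτε.le
    exact (mul_le_mul_of_nonneg_left (le_abs_self _) (sq_nonneg _)).trans
      (mul_le_of_le_one_left (abs_nonneg _) hsq)
  have hτ₀ε : (τ₀ (((ε ^ n : (𝓞 F)ˣ) : 𝓞 F) : F)) ^ 2 =
      (τ₀ ((ε : 𝓞 F) : F) ^ 2) ^ n := by
    simp [pow_right_comm]
  rw [← Finset.add_sum_erase _ _ (Finset.mem_univ τ₀), hτ₀ε]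
  linarith
end
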